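/- arXiv:1509.02829 — 2 statements merged into one kernel-verified Lean document; each statement's English description precedes it below -/
import Mathlib

section
/- For every n ≥ 1, the map Φ_n sending a noncrossing tree θ with n vertices to the pair (S(θ), C(θ)) consisting of its shape and its sequence of left-children counts is a bijection from NC_n onto the set T_n^dec of decorated plane trees with n vertices. -/
open Filter Set

noncomputable section

/-- The position `e^{-2iπk/n}` of the `k`-th among the `n`-th roots of unity,
labelled in clockwise order starting from the complex number `1`. -/
def ncPos (n k : ℕ) : ℂ := Complex.exp (-(2 * Real.pi * Complex.I) * k / n)

/-- A noncrossing tree with `n` vertices: a tree on the vertex set of `n`-th roots of unity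
whose edges, drawn as straight line segments, pairwise intersect only at common endpoints. -/
structure NCTree (n : ℕ) where
  adj : SimpleGraph (Fin n)
  isTree : adj.IsTree
  noncrossing : ∀ a b c d : Fin n, adj.Adj a b → adj.Adj c d →
    ({(a : ℕ), (b : ℕ)} : Set ℕ) ≠ {(c : ℕ), (d : ℕ)} →
    segment ℝ (ncPos n a) (ncPos n b) ∩ segment ℝ (ncPos n c) (ncPos n d) ⊆
      {z : ℂ | (z = ncPos n a ∨ z = ncPos n b) ∧ (z = ncPos n c ∨ z = ncPos n d)}

/-- A plane tree in Neveu's formalism: a finite set of finite words of positive integers,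
containing the root `[]`, closed under prefixes, and such that the children of a vertex `u`
are `u1, …, u k_u`. -/
structure PlaneTree where
  verts : Finset (List ℕ)
  root_mem : [] ∈ verts
  prefix_closed : ∀ u v : List ℕ, u <+: v → v ∈ verts → u ∈ verts
  labels_pos : ∀ u ∈ verts, ∀ i ∈ u, 1 ≤ i
  children_closed : ∀ (u : List ℕ) (i : ℕ), 1 ≤ i → u ++ [i + 1] ∈ verts → u ++ [i] ∈ verts

namespace PlaneTree

/-- The number of children of the vertex `u` in `τ`. -/
def kc (τ : PlaneTree) (u : List ℕ) : ℕ := Set.ncard {i : ℕ | u ++ [i] ∈ τ.verts}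

/-- The number of strict descendants of `u` in `τ`. -/
def descCount (τ : PlaneTree) (u : List ℕ) : ℕ :=
  Set.ncard {v : List ℕ | v ∈ τ.verts ∧ u <+: v ∧ v ≠ u}

/-- The number of vertices of the subtree grafted on `u` (that is, `u` and its descendants). -/
def subtreeSize (τ : PlaneTree) (u : List ℕ) : ℕ :=
  Set.ncard {v : List ℕ | v ∈ τ.verts ∧ u <+: v}

/-- The height of `τ`: the maximal generation of a vertex. -/
def height (τ : PlaneTree) : ℕ := τ.verts.sup List.length

/-- The `j`-th vertex of `τ` in lexicographical order (starting from `j = 0` for the root). -/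
def lexVertex (τ : PlaneTree) (j : ℕ) : List ℕ := (τ.verts.sort (· ≤ ·)).getD j []

/-- The Łukasiewicz path of `τ`: `W 0 = 0` and `W (j+1) = W j + k_{u(j)} - 1`, the vertices
being listed in lexicographical order. -/
def lukas (τ : PlaneTree) (j : ℕ) : ℤ :=
  (((τ.verts.sort (· ≤ ·)).take j).map fun u => (τ.kc u : ℤ) - 1).sum

end PlaneTree

/-- `IsShape n θ τ f` expresses that the plane tree `τ` is the shape of the noncrossing tree
`θ`, the correspondence between the vertices of `τ` and those of `θ` being given by `f`:
`f` is a bijection sending the root of `τ` to the vertex `1` of `θ`, sending parent-child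
pairs exactly to edges of `θ`, and the planar (clockwise, starting from the parent) order of
the children of each vertex agrees with their order in `τ`. -/
def IsShape (n : ℕ) (θ : NCTree n) (τ : PlaneTree) (f : List ℕ → Fin n) : Prop :=
  τ.verts.card = n ∧
  Set.BijOn f (↑τ.verts) Set.univ ∧
  (f ([] : List ℕ)).val = 0 ∧
  (∀ u ∈ τ.verts, u ≠ [] → θ.adj.Adj (f u.dropLast) (f u)) ∧
  (∀ u ∈ τ.verts, ∀ v ∈ τ.verts, θ.adj.Adj (f u) (f v) → u = v.dropLast ∨ v = u.dropLast) ∧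
  (∀ u ∈ τ.verts, ∀ i j : ℕ, 1 ≤ i → i < j → u ++ [j] ∈ τ.verts →
    f (u ++ [i]) - f u.dropLast < f (u ++ [j]) - f u.dropLast)

/-- `leftOf z w` : the point `w` lies in the (open) left half-plane bounded by the oriented
line from `z` to the complex number `1`. -/
def leftOf (z w : ℂ) : Prop := 0 < ((starRingEnd ℂ) (1 - z) * (w - z)).im

/-- The number of children of the vertex of `θ` corresponding to the vertex `u` of its shape
`τ` which lie to the left of it (in the left half-plane bounded by the line joining it to the
complex number `1`). -/
def leftCount (n : ℕ) (θ : NCTree n) (τ : PlaneTree) (f : List ℕ → Fin n) (u : List ℕ) : ℕ :=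
  Set.ncard {i : ℕ | u ++ [i] ∈ τ.verts ∧ leftOf (ncPos n (f u)) (ncPos n (f (u ++ [i])))}

/-- The degree of the vertex `v` in the noncrossing tree `θ`. -/
def ncDeg (n : ℕ) (θ : NCTree n) (v : Fin n) : ℕ := Set.ncard {w : Fin n | θ.adj.Adj v w}

/-- The noncrossing tree `θ` viewed as the compact subset of the closed unit disk given by
the union of its edges. -/
def ncSet (n : ℕ) (θ : NCTree n) : Set ℂ :=
  ⋃ (a : Fin n) (b : Fin n) (_ : θ.adj.Adj a b), segment ℝ (ncPos n a) (ncPos n b)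

end

/-- A decoration of a plane tree `τ` with `n` vertices: a sequence `c 1, …, c (n-1)` of labels
with `0 ≤ c j ≤ k_{u(j)}(τ)` for the vertices `u(1) ≺ … ≺ u(n-1)` in lexicographical order
(we normalise `c j = 0` outside this range). -/
def DecOK (n : ℕ) (τ : PlaneTree) (c : ℕ → ℕ) : Prop :=
  τ.verts.card = n ∧ (∀ j : ℕ, 1 ≤ j → j < n → c j ≤ τ.kc (τ.lexVertex j)) ∧
  (∀ j : ℕ, j = 0 ∨ n ≤ j → c j = 0)

/-- `ShapeDec n θ τ c` : the noncrossing tree `θ` has shape `S(θ) = τ` and left-children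
counts `C(θ) = c`, i.e. `Φ_n θ = (τ, c)`. -/
def ShapeDec (n : ℕ) (θ : NCTree n) (τ : PlaneTree) (c : ℕ → ℕ) : Prop :=
  ∃ f : List ℕ → Fin n, IsShape n θ τ f ∧
    (∀ j : ℕ, 1 ≤ j → j < n → c j = leftCount n θ τ f (τ.lexVertex j)) ∧
    (∀ j : ℕ, j = 0 ∨ n ≤ j → c j = 0)

namespace NCT

/-- cross product -/
def crs (a b c : ℂ) : ℝ := (b.re - a.re) * (c.im - a.im) - (b.im - a.im) * (c.re - a.re)

lemma ncPos_re (n k : ℕ) : (ncPos n k).re = Real.cos (2 * (Real.pi * k / n)) := by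
  have : ncPos n k = Complex.exp (((-(2 * (Real.pi * k / n)) : ℝ) : ℂ) * Complex.I) := by
    unfold ncPos; congr 1; push_cast; ring
  rw [this, Complex.exp_ofReal_mul_I_re, Real.cos_neg]

lemma ncPos_im (n k : ℕ) : (ncPos n k).im = - Real.sin (2 * (Real.pi * k / n)) := by
  have : ncPos n k = Complex.exp (((-(2 * (Real.pi * k / n)) : ℝ) : ℂ) * Complex.I) := by
    unfold ncPos; congr 1; push_cast; ring
  rw [this, Complex.exp_ofReal_mul_I_im, Real.sin_neg]

lemma crs_trig (a b c : ℝ) :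
    (Real.cos (2 * b) - Real.cos (2 * a)) * (-Real.sin (2 * c) - -Real.sin (2 * a)) -
      (-Real.sin (2 * b) - -Real.sin (2 * a)) * (Real.cos (2 * c) - Real.cos (2 * a)) =
    -(4 * (Real.sin (b - a) * Real.sin (c - a) * Real.sin (c - b))) := by
  have h1 : ∀ x y : ℝ, Real.cos (2 * x) - Real.cos (2 * y) =
      -2 * Real.sin (x + y) * Real.sin (x - y) := by
    intro x y
    rw [Real.cos_sub_cos]; congr 2 <;> congr 1 <;> ring
  have h2 : ∀ x y : ℝ, Real.sin (2 * x) - Real.sin (2 * y) =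
      2 * Real.sin (x - y) * Real.cos (x + y) := by
    intro x y
    rw [Real.sin_sub_sin]; congr 2 <;> congr 1 <;> ring
  have h3 : Real.sin (c - b) = Real.sin (c + a) * Real.cos (b + a) -
      Real.cos (c + a) * Real.sin (b + a) := by
    rw [← Real.sin_sub]; congr 1; ring
  have e1 := h1 b a
  have e2 := h1 c a
  have e3 := h2 b a
  have e4 := h2 c a
  rw [h3]
  have e5 : -Real.sin (2 * c) - -Real.sin (2 * a) = -(Real.sin (2 * c) - Real.sin (2 * a)) := by ring
  have e6 : -Real.sin (2 * b) - -Real.sin (2 * a) = -(Real.sin (2 * b) - Real.sin (2 * a)) := by ring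
  rw [e5, e6, e1, e2, e3, e4]; ring

lemma crs_neg (n i j k : ℕ) (h1 : i < j) (h2 : j < k) (h3 : k < n) :
    crs (ncPos n i) (ncPos n j) (ncPos n k) < 0 := by
  unfold crs
  rw [ncPos_re, ncPos_re, ncPos_re, ncPos_im, ncPos_im, ncPos_im, crs_trig]
  have hn : (0 : ℝ) < n := by exact_mod_cast (by omega : 0 < n)
  have key : ∀ x y : ℕ, x < y → y < n →
      0 < Real.sin (Real.pi * y / n - Real.pi * x / n) := by
    intro x y hxy hy
    have hxy' : (x : ℝ) < y := by exact_mod_cast hxy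
    have hy' : (y : ℝ) < n := by exact_mod_cast hy
    have hx0 : (0 : ℝ) ≤ x := by positivity
    have e : Real.pi * y / n - Real.pi * x / n = Real.pi * ((y - x) / n) := by ring
    rw [e]
    apply Real.sin_pos_of_pos_of_lt_pi
    · have : 0 < ((y : ℝ) - x) / n := div_pos (by linarith) hn
      have := Real.pi_pos
      positivity
    · have : ((y : ℝ) - x) / n < 1 := by rw [div_lt_one hn]; linarith
      have := Real.pi_pos
      nlinarith
  have := key i j h1 (by omega)
  have := key i k (by omega) h3
  have := key j k h2 h3
  have : 0 < 4 * (Real.sin (Real.pi * j / n - Real.pi * i / n) *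
    Real.sin (Real.pi * k / n - Real.pi * i / n) *
    Real.sin (Real.pi * k / n - Real.pi * j / n)) := by positivity
  linarith

lemma crs_rot (a b c : ℂ) : crs b c a = crs a b c := by unfold crs; ring
lemma crs_swap (a b c : ℂ) : crs b a c = - crs a b c := by unfold crs; ring
lemma crs_left (a b : ℂ) : crs a b a = 0 := by unfold crs; ring
lemma crs_right (a b : ℂ) : crs a b b = 0 := by unfold crs; ring

lemma crs_seg (a b c d : ℂ) (s t : ℝ) (h : s + t = 1) :
    crs a b (s • c + t • d) = s * crs a b c + t * crs a b d := by
  have : t = 1 - s := by linarith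
  subst this
  simp only [crs, Complex.add_re, Complex.add_im, Complex.real_smul, Complex.mul_re,
    Complex.mul_im, Complex.ofReal_re, Complex.ofReal_im]
  ring

lemma crs_on_seg (a b z : ℂ) (hz : z ∈ segment ℝ a b) : crs a b z = 0 := by
  obtain ⟨s, t, _, _, h, rfl⟩ := hz
  rw [crs_seg _ _ _ _ _ _ h, crs_left, crs_right]; ring

lemma leftOf_iff (n a b : ℕ) (ha : 0 < a) (han : a < n) (hb : b < n) :
    leftOf (ncPos n a) (ncPos n b) ↔ a < b := by
  have h1 : (1 : ℂ) = ncPos n 0 := by simp [ncPos]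
  have : ((starRingEnd ℂ) (1 - ncPos n a) * (ncPos n b - ncPos n a)).im =
      crs (ncPos n a) (ncPos n 0) (ncPos n b) := by
    rw [h1]; simp [crs, Complex.mul_im]; ring
  unfold leftOf
  rw [this, crs_swap]
  rcases lt_trichotomy a b with h | h | h
  · have := crs_neg n 0 a b ha h hb
    simp only [h, iff_true]; linarith
  · subst h; simp [crs_right]
  · rcases Nat.eq_zero_or_pos b with hb0 | hb0
    · subst hb0; simp [crs_left]
    · have := crs_neg n 0 b a hb0 h han
      have e : crs (ncPos n 0) (ncPos n a) (ncPos n b) =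
        - crs (ncPos n 0) (ncPos n b) (ncPos n a) := by unfold crs; ring
      rw [e]
      constructor
      · intro h'; linarith
      · intro h'; omega

/-- sign of cross product when `c` strictly inside -/
lemma crs_in (n a b c : ℕ) (h1 : a < c) (h2 : c < b) (h3 : b < n) :
    0 < crs (ncPos n a) (ncPos n b) (ncPos n c) := by
  have := crs_neg n a c b h1 h2 h3
  have e : crs (ncPos n a) (ncPos n b) (ncPos n c) =
        - crs (ncPos n a) (ncPos n c) (ncPos n b) := by unfold crs; ring
  linarith

lemma crs_out (n a b c : ℕ) (h1 : a < b) (h2 : c < a ∨ b < c) (h3 : b < n) (h4 : c < n) :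
    crs (ncPos n a) (ncPos n b) (ncPos n c) < 0 := by
  rcases h2 with h2 | h2
  · have := crs_neg n c a b h2 h1 h3
    rwa [crs_rot]
  · exact crs_neg n a b c h1 h2 h4

lemma no_interleave {n : ℕ} (θ : NCTree n) (a b c d : Fin n) (hab : θ.adj.Adj a b)
    (hcd : θ.adj.Adj c d) (h1 : a < c) (h2 : c < b) (h3 : b < d) : False := by
  have h1' : a.val < c.val := h1
  have h2' : c.val < b.val := h2
  have h3' : b.val < d.val := h3
  have hne : ({(a : ℕ), (b : ℕ)} : Set ℕ) ≠ {(c : ℕ), (d : ℕ)} := by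
    intro h
    have : (a : ℕ) ∈ ({(c : ℕ), (d : ℕ)} : Set ℕ) := by rw [← h]; simp
    simp only [Set.mem_insert_iff, Set.mem_singleton_iff] at this
    omega
  have hx := θ.noncrossing a b c d hab hcd hne
  have p1 := crs_in n a b c h1' h2' b.2
  have p2 := crs_out n a b d (by omega) (Or.inr h3') b.2 d.2
  have p3 := crs_out n c d a (by omega) (Or.inl h1') d.2 a.2
  have p4 := crs_in n c d b h2' h3' d.2
  set A := ncPos n a with hA
  set B := ncPos n b with hB
  set C := ncPos n c with hC
  set D := ncPos n d with hD
  have hz1 : (crs C D B / (crs C D B - crs C D A)) • A +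
      (- crs C D A / (crs C D B - crs C D A)) • B ∈ segment ℝ A B := by
    refine ⟨_, _, ?_, ?_, ?_, rfl⟩
    · apply div_nonneg <;> linarith
    · apply div_nonneg <;> linarith
    · have : crs C D B - crs C D A ≠ 0 := by linarith
      field_simp; ring
  have heq : (crs C D B / (crs C D B - crs C D A)) • A +
      (- crs C D A / (crs C D B - crs C D A)) • B =
      (- crs A B D / (crs A B C - crs A B D)) • C +
      (crs A B C / (crs A B C - crs A B D)) • D := by
    have q1 : crs C D B - crs C D A ≠ 0 := by linarith
    have q2 : crs A B C - crs A B D ≠ 0 := by linarith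
    apply Complex.ext
    · simp only [Complex.add_re, Complex.real_smul, Complex.mul_re,
        Complex.ofReal_re, Complex.ofReal_im]
      field_simp
      unfold crs; ring
    · simp only [Complex.add_im, Complex.real_smul, Complex.mul_im,
        Complex.ofReal_re, Complex.ofReal_im]
      field_simp
      unfold crs; ring
  have hz2 : (crs C D B / (crs C D B - crs C D A)) • A +
      (- crs C D A / (crs C D B - crs C D A)) • B ∈ segment ℝ C D := by
    rw [heq]
    refine ⟨_, _, ?_, ?_, ?_, rfl⟩
    · apply div_nonneg <;> linarith
    · apply div_nonneg <;> linarith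
    · have : crs A B C - crs A B D ≠ 0 := by linarith
      field_simp; ring
  have := crs_on_seg _ _ _ hz2
  rcases (hx ⟨hz1, hz2⟩).1 with h | h <;> rw [h] at this <;> linarith

lemma seg_inter (n a b c d : ℕ) (hab : a < b) (hb : b < n) (hc : c < n) (hd : d < n)
    (hcd : c < d) (hne : ¬ (a = c ∧ b = d))
    (h1 : ¬ (a < c ∧ c < b ∧ b < d)) (h2 : ¬ (c < a ∧ a < d ∧ d < b)) (z : ℂ)
    (hz1 : z ∈ segment ℝ (ncPos n a) (ncPos n b))
    (hz2 : z ∈ segment ℝ (ncPos n c) (ncPos n d)) :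
    (z = ncPos n a ∨ z = ncPos n b) ∧ (z = ncPos n c ∨ z = ncPos n d) := by
  have h0 := crs_on_seg _ _ _ hz1
  obtain ⟨s, t, hs, ht, hst, rfl⟩ := hz2
  rw [crs_seg _ _ _ _ _ _ hst] at h0
  have onC : t * 0 = t * 0 → t = 0 → (c = a ∨ c = b) →
     (s • ncPos n c + t • ncPos n d = ncPos n a ∨ s • ncPos n c + t • ncPos n d = ncPos n b) ∧
     (s • ncPos n c + t • ncPos n d = ncPos n c ∨ s • ncPos n c + t • ncPos n d = ncPos n d) := by
    intro _ h hc
    have : s = 1 := by linarith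
    subst h this
    rcases hc with rfl | rfl <;> simp
  have onD : s = 0 → (d = a ∨ d = b) →
     (s • ncPos n c + t • ncPos n d = ncPos n a ∨ s • ncPos n c + t • ncPos n d = ncPos n b) ∧
     (s • ncPos n c + t • ncPos n d = ncPos n c ∨ s • ncPos n c + t • ncPos n d = ncPos n d) := by
    intro h hc
    have : t = 1 := by linarith
    subst h this
    rcases hc with rfl | rfl <;> simp
  have cl : ∀ x, x < n → (x = a ∨ x = b) ∨ (a < x ∧ x < b) ∨ (x < a ∨ b < x) := by
    intro x _; omega
  have zr : ∀ x, (x = a ∨ x = b) → crs (ncPos n a) (ncPos n b) (ncPos n x) = 0 := by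
    rintro x (rfl | rfl)
    · exact crs_left _ _
    · exact crs_right _ _
  rcases cl c hc with hc1 | hc1 | hc1 <;> rcases cl d hd with hd1 | hd1 | hd1
  · omega
  · rw [zr c hc1] at h0
    have := crs_in n a b d hd1.1 hd1.2 hb
    exact onC rfl (by nlinarith) hc1
  · rw [zr c hc1] at h0
    have := crs_out n a b d hab hd1 hb hd
    exact onC rfl (by nlinarith) hc1
  · rw [zr d hd1] at h0
    have := crs_in n a b c hc1.1 hc1.2 hb
    exact onD (by nlinarith) hd1
  · have := crs_in n a b d hd1.1 hd1.2 hb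
    have := crs_in n a b c hc1.1 hc1.2 hb
    exfalso; rcases hs.lt_or_eq with h | h
    · nlinarith [mul_pos h ‹0 < crs (ncPos n a) (ncPos n b) (ncPos n c)›]
    · subst h; have : t = 1 := by linarith
      subst this; linarith
  · omega
  · rw [zr d hd1] at h0
    have := crs_out n a b c hab hc1 hb hc
    exact onD (by nlinarith) hd1
  · omega
  · have q1 := crs_out n a b d hab hd1 hb hd
    have q2 := crs_out n a b c hab hc1 hb hc
    exfalso; rcases hs.lt_or_eq with h | h
    · nlinarith [mul_pos h (neg_pos.mpr q2)]
    · subst h; have : t = 1 := by linarith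
      subst this; linarith

end NCT
namespace NCT

open Classical in
/-- rank of `x` among `S` for the key `κ` -/
noncomputable def rk {α β : Type*} [LinearOrder β] (S : Finset α) (κ : α → β) (x : α) : ℕ :=
  (S.filter (fun y => κ y < κ x)).card

lemma rk_mono {α β : Type*} [LinearOrder β] (S : Finset α) (κ : α → β) (a b : α)
    (h : κ a ≤ κ b) : rk S κ a ≤ rk S κ b := by
  classical
  apply Finset.card_le_card
  intro x hx
  simp only [Finset.mem_filter] at hx ⊢
  exact ⟨hx.1, hx.2.trans_le h⟩

lemma rk_lt {α β : Type*} [LinearOrder β] (S : Finset α) (κ : α → β) (a b : α) (ha : a ∈ S)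
    (h : κ a < κ b) : rk S κ a < rk S κ b := by
  classical
  apply Finset.card_lt_card
  refine ⟨?_, ?_⟩
  · intro x hx
    simp only [Finset.mem_filter] at hx ⊢
    exact ⟨hx.1, hx.2.trans h⟩
  · intro hh
    have := hh (Finset.mem_filter.mpr ⟨ha, h⟩)
    simp at this

lemma rk_lt_card {α β : Type*} [LinearOrder β] (S : Finset α) (κ : α → β) (a : α) (ha : a ∈ S) :
    rk S κ a < S.card := by
  classical
  apply Finset.card_lt_card
  refine ⟨Finset.filter_subset _ _, ?_⟩
  intro hh
  have := hh ha
  simp at this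

lemma rk_pred {α β : Type*} [LinearOrder β] (S : Finset α) (κ : α → β)
    (hκ : Set.InjOn κ (S : Set α)) (v : α) (m : ℕ) (h : rk S κ v = m + 1) :
    ∃ w ∈ S, rk S κ w = m := by
  classical
  have hne : (S.filter (fun y => κ y < κ v)).Nonempty := by
    rw [← Finset.card_pos]; unfold rk at h; omega
  obtain ⟨w, hw, hmax⟩ := Finset.exists_max_image _ κ hne
  rw [Finset.mem_filter] at hw
  refine ⟨w, hw.1, ?_⟩
  have : S.filter (fun y => κ y < κ v) = insert w (S.filter (fun y => κ y < κ w)) := by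
    ext x
    simp only [Finset.mem_filter, Finset.mem_insert]
    constructor
    · rintro ⟨hx, hxv⟩
      rcases (hmax x (Finset.mem_filter.mpr ⟨hx, hxv⟩)).lt_or_eq with h | h
      · exact Or.inr ⟨hx, h⟩
      · exact Or.inl (hκ hx hw.1 h)
    · rintro (rfl | ⟨hx, h⟩)
      · exact hw
      · exact ⟨hx, h.trans hw.2⟩
  unfold rk at h ⊢
  rw [this, Finset.card_insert_of_notMem (by simp)] at h
  omega

lemma tree_parent {n : ℕ} (G : SimpleGraph (Fin n)) (hG : G.IsTree) (r : Fin n) :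
    ∃ (par : Fin n → Fin n) (d : Fin n → ℕ), par r = r ∧ d r = 0 ∧
      (∀ v, v ≠ r → G.Adj (par v) v ∧ d v = d (par v) + 1) ∧
      (∀ v w, G.Adj v w → (w ≠ r ∧ v = par w) ∨ (v ≠ r ∧ w = par v)) := by
  choose p hp using fun v => (hG.existsUnique_path r v).exists
  have hr : p r = SimpleGraph.Walk.nil := by
    have := hp r
    rwa [SimpleGraph.Walk.isPath_iff_eq_nil] at this
  have nn : ∀ v, v ≠ r → ¬ (p v).Nil := by
    intro v hv h
    exact hv h.eq.symm
  have adj : ∀ v, v ≠ r → G.Adj (p v).penultimate v := fun v hv =>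
    SimpleGraph.Walk.adj_penultimate (nn v hv)
  have rmem : ∀ v, r ∈ (p v).support := fun v => (p v).start_mem_support
  refine ⟨fun v => (p v).penultimate, fun v => (p v).length, ?_, ?_, ?_, ?_⟩
  · simp only [hr]; rfl
  · simp [hr]
  · intro v hv
    refine ⟨adj v hv, ?_⟩
    have h1 : (p v).penultimate ∈ (p v).support := SimpleGraph.Walk.getVert_mem_support _ _
    have h2 := hG.isAcyclic.path_concat (hp _) (hp v) (adj v hv) h1
    have h3 := congrArg SimpleGraph.Walk.length h2
    rwa [SimpleGraph.Walk.length_concat] at h3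
  · intro v w h
    by_cases hm : w ∈ (p v).support
    · right
      refine ⟨?_, hG.isAcyclic.eq_penultimate_of_adj_end (hp v) h hm⟩
      rintro rfl
      rw [hr] at hm
      simp at hm
      exact h.ne hm.symm
    · left
      have hm' := hG.isAcyclic.mem_support_of_ne_mem_support_of_adj_of_isPath (hp w) (hp v) h.symm hm
      refine ⟨?_, hG.isAcyclic.eq_penultimate_of_adj_end (hp w) h.symm hm'⟩
      rintro rfl
      exact hm (rmem v)

open Classical in
/-- index of `v` among its siblings -/
noncomputable def idx {n : ℕ} (par : Fin n → Fin n) (r v : Fin n) : ℕ :=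
  1 + rk (Finset.univ.filter (fun w => w ≠ r ∧ par w = par v)) (fun w => w - par (par v)) v

/-- fuelled word -/
noncomputable def wd {n : ℕ} (par : Fin n → Fin n) (r : Fin n) : ℕ → Fin n → List ℕ
  | 0, _ => []
  | m + 1, v => wd par r m (par v) ++ [idx par r v]

/-- rooted-tree words -/
structure WD {n : ℕ} (G : SimpleGraph (Fin n)) (r : Fin n) (par : Fin n → Fin n)
    (word : Fin n → List ℕ) : Prop where
  par_r : par r = r
  word_r : word r = []
  adj : ∀ v, v ≠ r → G.Adj (par v) v
  adj_cases : ∀ v w, G.Adj v w → (w ≠ r ∧ v = par w) ∨ (v ≠ r ∧ w = par v)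
  word_par : ∀ v, v ≠ r → word v = word (par v) ++ [idx par r v]

lemma exists_WD {n : ℕ} (G : SimpleGraph (Fin n)) (hG : G.IsTree) (r : Fin n) :
    ∃ par word, WD G r par word := by
  obtain ⟨par, d, h1, h2, h3, h4⟩ := tree_parent G hG r
  refine ⟨par, fun v => wd par r (d v) v, h1, ?_, fun v hv => (h3 v hv).1, h4, ?_⟩
  · simp [h2, wd]
  · intro v hv
    simp only [(h3 v hv).2, wd]

lemma sub_inj {n : ℕ} [NeZero n] (p a b : Fin n) (h : a - p = b - p) : a = b :=
  sub_left_injective h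

lemma idx_eq {n : ℕ} [NeZero n] (par : Fin n → Fin n) (r v w : Fin n) (hv : v ≠ r) (hw : w ≠ r)
    (h1 : par v = par w) (h2 : idx par r v = idx par r w) : v = w := by
  unfold idx at h2
  rw [h1] at h2
  rcases lt_trichotomy (v - par (par w)) (w - par (par w)) with h | h | h
  · have := rk_lt (Finset.univ.filter (fun x => x ≠ r ∧ par x = par w))
      (fun x => x - par (par w)) v w (by simp [hv, h1]) h
    omega
  · exact sub_inj _ _ _ h
  · have := rk_lt (Finset.univ.filter (fun x => x ≠ r ∧ par x = par w))
      (fun x => x - par (par w)) w v (by simp [hw]) h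
    omega

lemma word_inj {n : ℕ} [NeZero n] {G : SimpleGraph (Fin n)} {r : Fin n} {par word}
    (h : WD G r par word) : Function.Injective word := by
  have : ∀ u : List ℕ, ∀ v w, word v = u → word w = u → v = w := by
    intro u
    induction u using List.reverseRecOn with
    | nil =>
      have : ∀ v, word v = [] → v = r := by
        intro v hv
        by_contra hne
        rw [h.word_par v hne] at hv
        simp at hv
      intro v w hv hw
      rw [this v hv, this w hw]
    | append_singleton u i ih =>
      intro v w hv hw
      have nr : ∀ v, word v = u ++ [i] → v ≠ r := by
        rintro v hv rfl
        rw [h.word_r] at hv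
        simp at hv
      have h1 := nr v hv
      have h2 := nr w hw
      rw [h.word_par v h1] at hv
      rw [h.word_par w h2] at hw
      obtain ⟨hv1, hv2⟩ := List.append_inj' hv rfl
      obtain ⟨hw1, hw2⟩ := List.append_inj' hw rfl
      have := ih _ _ hv1 hw1
      exact idx_eq par r v w h1 h2 this (by simp at hv2 hw2; omega)
  intro v w hvw
  exact this _ v w rfl hvw.symm

lemma child_le (τ : PlaneTree) (u : List ℕ) (i j : ℕ) (h1 : 1 ≤ i) (h : i ≤ j)
    (hj : u ++ [j] ∈ τ.verts) : u ++ [i] ∈ τ.verts := by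
  induction j, h using Nat.le_induction with
  | base => exact hj
  | succ k hk ih => exact ih (τ.children_closed u k (by omega) hj)

lemma word_concat {n : ℕ} [NeZero n] {G : SimpleGraph (Fin n)} {r : Fin n} {par word}
    (h : WD G r par word) (v : Fin n) (u : List ℕ) (i : ℕ) (hv : word v = u ++ [i]) :
    v ≠ r ∧ word (par v) = u ∧ idx par r v = i := by
  have h1 : v ≠ r := by
    rintro rfl
    rw [h.word_r] at hv
    simp at hv
  rw [h.word_par v h1] at hv
  obtain ⟨hv1, hv2⟩ := List.append_inj' hv rfl
  exact ⟨h1, hv1, by simpa using hv2⟩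

/-- the plane tree of words -/
noncomputable def treeOf {n : ℕ} [NeZero n] {G : SimpleGraph (Fin n)} {r : Fin n} {par word}
    (h : WD G r par word) : PlaneTree where
  verts := Finset.univ.image word
  root_mem := by
    rw [Finset.mem_image]; exact ⟨r, Finset.mem_univ _, h.word_r⟩
  prefix_closed := by
    intro u v
    induction v using List.reverseRecOn with
    | nil => intro hu hv; rw [List.prefix_nil] at hu; rwa [hu]
    | append_singleton w i ih =>
      intro hu hv
      rw [List.prefix_concat_iff] at hu
      rcases hu with rfl | hu
      · exact hv
      · apply ih hu
        simp only [Finset.mem_image, Finset.mem_univ, true_and] at hv ⊢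
        obtain ⟨x, hx⟩ := hv
        exact ⟨par x, (word_concat h x _ _ hx).2.1⟩
  labels_pos := by
    intro u
    induction u using List.reverseRecOn with
    | nil => simp
    | append_singleton w i ih =>
      intro hv
      simp only [Finset.mem_image, Finset.mem_univ, true_and] at hv ih
      obtain ⟨x, hx⟩ := hv
      obtain ⟨_, h2, h3⟩ := word_concat h x _ _ hx
      intro j hj
      simp only [List.mem_append, List.mem_singleton] at hj
      rcases hj with hj | rfl
      · exact ih ⟨_, h2⟩ j hj
      · rw [← h3]; unfold idx; omega
  children_closed := by
    intro u i hi hu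
    simp only [Finset.mem_image, Finset.mem_univ, true_and] at hu ⊢
    obtain ⟨x, hx⟩ := hu
    obtain ⟨h1, h2, h3⟩ := word_concat h x _ _ hx
    unfold idx at h3
    obtain ⟨w, hw, hw2⟩ := rk_pred (Finset.univ.filter (fun w => w ≠ r ∧ par w = par x))
      (fun w => w - par (par x)) (fun a _ b _ hab => sub_inj _ _ _ hab) x (i - 1) (by omega)
    simp only [Finset.mem_filter, Finset.mem_univ, true_and] at hw
    refine ⟨w, ?_⟩
    rw [h.word_par w hw.1, hw.2, h2]
    unfold idx
    rw [hw.2, hw2]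
    congr 2; omega

lemma shape_exists {n : ℕ} [NeZero n] (θ : NCTree n) : ∃ τ f, IsShape n θ τ f := by
  obtain ⟨par, word, h⟩ := exists_WD θ.adj θ.isTree 0
  have hinj := word_inj h
  refine ⟨treeOf h, Function.invFun word, ?_⟩
  have hf : ∀ v, Function.invFun word (word v) = v := Function.leftInverse_invFun hinj
  have hmem : ∀ u, u ∈ (treeOf h).verts ↔ ∃ v, word v = u := by
    intro u; simp [treeOf]
  have hdl : ∀ v, (word v).dropLast = word (par v) := by
    intro v
    by_cases hv : v = 0
    · subst hv; rw [h.par_r, h.word_r]; rfl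
    · rw [h.word_par v hv]; simp
  refine ⟨?_, ⟨?_, ?_, ?_⟩, ?_, ?_, ?_, ?_⟩
  · simp only [treeOf]; rw [Finset.card_image_of_injective _ hinj]; simp
  · intro _ _; exact Set.mem_univ _
  · intro a ha b hb hab
    obtain ⟨x, rfl⟩ := (hmem a).1 ha
    obtain ⟨y, rfl⟩ := (hmem b).1 hb
    rw [hf, hf] at hab; rw [hab]
  · intro v _
    exact ⟨word v, (hmem _).2 ⟨v, rfl⟩, hf v⟩
  · rw [← h.word_r, hf]; rfl
  · intro u hu hne
    obtain ⟨x, rfl⟩ := (hmem u).1 hu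
    rw [hdl, hf, hf]
    apply h.adj
    rintro rfl
    exact hne h.word_r
  · intro u hu v hv hadj
    obtain ⟨x, rfl⟩ := (hmem u).1 hu
    obtain ⟨y, rfl⟩ := (hmem v).1 hv
    rw [hf, hf] at hadj
    rw [hdl, hdl]
    rcases h.adj_cases x y hadj with ⟨_, e⟩ | ⟨_, e⟩
    · left; rw [← e]
    · right; rw [← e]
  · intro u hu i j hi hij hj
    have hi' := child_le _ u i j hi hij.le hj
    obtain ⟨v, rfl⟩ := (hmem u).1 hu
    obtain ⟨a, ha⟩ := (hmem _).1 hi'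
    obtain ⟨b, hb⟩ := (hmem _).1 hj
    rw [← ha, ← hb, hf, hf, hdl, hf]
    obtain ⟨a1, a2, a3⟩ := word_concat h a _ _ ha
    obtain ⟨b1, b2, b3⟩ := word_concat h b _ _ hb
    have a4 := hinj a2
    have b4 := hinj b2
    by_contra hc
    push Not at hc
    unfold idx at a3 b3
    rw [a4] at a3
    rw [b4] at b3
    have := rk_mono (Finset.univ.filter (fun w => w ≠ 0 ∧ par w = v)) (fun w => w - par v) b a hc
    omega

lemma PlaneTree_ext (τ τ' : PlaneTree) (h : τ.verts = τ'.verts) : τ = τ' := by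
  cases τ; cases τ'; simp at h; subst h; rfl

lemma dl_mem (τ : PlaneTree) (u : List ℕ) (hu : u ∈ τ.verts) : u.dropLast ∈ τ.verts :=
  τ.prefix_closed _ _ (List.dropLast_prefix u) hu

lemma app_mem (τ : PlaneTree) (u v : List ℕ) (hu : u ++ v ∈ τ.verts) : u ∈ τ.verts :=
  τ.prefix_closed _ _ (List.prefix_append u v) hu

lemma shape_par {n : ℕ} [NeZero n] {θ : NCTree n} {τ f} (hs : IsShape n θ τ f) {par word}
    (h : WD θ.adj 0 par word) (u : List ℕ) (hu : u ∈ τ.verts) : par (f u) = f u.dropLast := by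
  obtain ⟨_, ⟨_, hinj, _⟩, h0, hadj, _, _⟩ := hs
  have h0' : f [] = 0 := Fin.ext h0
  induction u using List.reverseRecOn with
  | nil => simp only [List.dropLast_nil]; rw [h0', h.par_r]
  | append_singleton w i ih =>
    have hw := app_mem _ _ _ hu
    have := hadj _ hu (by simp)
    simp only [List.dropLast_concat] at this ⊢
    rcases h.adj_cases _ _ this with ⟨_, e⟩ | ⟨_, e⟩
    · exact e.symm
    · rw [ih hw] at e
      have := hinj hu (dl_mem _ _ hw) e
      have := congrArg List.length this
      simp at this; omega

lemma shape_word {n : ℕ} [NeZero n] {θ : NCTree n} {τ f} (hs : IsShape n θ τ f) {par word}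
    (h : WD θ.adj 0 par word) (u : List ℕ) (hu : u ∈ τ.verts) : word (f u) = u := by
  have hpar := shape_par hs h
  obtain ⟨_, ⟨_, hinj, hsurj⟩, h0, hadj, _, hord⟩ := hs
  have h0' : f [] = 0 := Fin.ext h0
  induction u using List.reverseRecOn with
  | nil => rw [h0', h.word_r]
  | append_singleton w i ih =>
    have hw := app_mem _ _ _ hu
    have hi1 : 1 ≤ i := τ.labels_pos _ hu i (by simp)
    have nz : ∀ v ∈ τ.verts, v ≠ [] → f v ≠ 0 := by
      intro v hv hne e
      rw [← h0'] at e
      exact hne (hinj hv τ.root_mem e)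
    have hp := hpar _ hu
    simp only [List.dropLast_concat] at hp
    rw [h.word_par _ (nz _ hu (by simp)), hp, ih hw]
    congr 2
    unfold idx
    rw [hp, hpar _ hw]
    have : rk (Finset.univ.filter (fun x => x ≠ 0 ∧ par x = f w)) (fun x => x - f w.dropLast)
        (f (w ++ [i])) = i - 1 := by
      classical
      unfold rk
      have e : ((Finset.univ.filter (fun x => x ≠ 0 ∧ par x = f w)).filter
          (fun x => x - f w.dropLast < f (w ++ [i]) - f w.dropLast)) =
          (Finset.Ico 1 i).image (fun j => f (w ++ [j])) := by
        ext x
        simp only [Finset.mem_filter, Finset.mem_univ, true_and, Finset.mem_image, Finset.mem_Ico]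
        constructor
        · rintro ⟨⟨hx0, hx1⟩, hx2⟩
          obtain ⟨y, hy, rfl⟩ := hsurj (Set.mem_univ x)
          have hy : y ∈ τ.verts := hy
          have hyne : y ≠ [] := by rintro rfl; exact hx0 h0'
          rw [hpar _ hy] at hx1
          have hd := hinj (dl_mem _ _ hy) hw hx1
          obtain ⟨y', j, rfl⟩ : ∃ y' j, y = y' ++ [j] :=
            ⟨_, _, (List.dropLast_append_getLast hyne).symm⟩
          simp only [List.dropLast_concat] at hd
          subst hd
          refine ⟨j, ⟨τ.labels_pos _ hy j (by simp), ?_⟩, rfl⟩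
          rcases lt_trichotomy j i with h | h | h
          · exact h
          · subst h; exact absurd hx2 (lt_irrefl _)
          · exact absurd hx2 (lt_asymm (hord _ hw i j hi1 h hy))
        · rintro ⟨j, ⟨hj1, hj2⟩, rfl⟩
          have hj := child_le τ w j i hj1 hj2.le hu
          refine ⟨⟨nz _ hj (by simp), ?_⟩, hord _ hw j i hj1 hj2 hu⟩
          rw [hpar _ hj]; simp
      have e2 := congrArg Finset.card e
      rw [Finset.card_image_of_injOn, Nat.card_Ico] at e2
      · convert e2
      · intro a ha b hb hab
        simp only [Finset.coe_Ico, Set.mem_Ico] at ha hb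
        have := hinj (child_le τ w a i ha.1 ha.2.le hu) (child_le τ w b i hb.1 hb.2.le hu) hab
        simpa using this
    rw [this]; omega

lemma shape_unique {n : ℕ} [NeZero n] (θ : NCTree n) (τ τ' f f') (hs : IsShape n θ τ f)
    (hs' : IsShape n θ τ' f') : τ = τ' ∧ ∀ u ∈ τ.verts, f u = f' u := by
  obtain ⟨par, word, h⟩ := exists_WD θ.adj θ.isTree 0
  have key : ∀ τ f, IsShape n θ τ f → τ.verts = Finset.univ.image word := by
    intro τ f hs
    ext u
    simp only [Finset.mem_image, Finset.mem_univ, true_and]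
    constructor
    · intro hu; exact ⟨_, shape_word hs h u hu⟩
    · rintro ⟨v, rfl⟩
      obtain ⟨y, hy, rfl⟩ := hs.2.1.2.2 (Set.mem_univ v)
      rw [shape_word hs h y hy]; exact hy
  have e := PlaneTree_ext τ τ' ((key τ f hs).trans (key τ' f' hs').symm)
  refine ⟨e, ?_⟩
  subst e
  intro u hu
  apply word_inj h
  rw [shape_word hs h u hu, shape_word hs' h u hu]

end NCT
namespace NCT

lemma fin_sub_lt {n : ℕ} (a b p : Fin n) (h : a < p ↔ b < p) : a - p < b - p ↔ a < b := by
  have key : ∀ x : Fin n, (x - p).val = if x.val < p.val then n - p + x else x - p := by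
    intro x
    have := x.2
    have := p.2
    rw [Fin.sub_def]
    simp only
    split_ifs with hx
    · exact Nat.mod_eq_of_lt (by omega)
    · rw [show n - p.val + x.val = (x.val - p.val) + n by omega, Nat.add_mod_right]
      exact Nat.mod_eq_of_lt (by omega)
  have h' : a.val < p.val ↔ b.val < p.val := h
  rw [Fin.lt_def, Fin.lt_def, key, key]
  have := p.2
  split_ifs <;> omega

/-- the sign-coded child index -/
def code (m i : ℕ) : ℤ := if i ≤ m then (i : ℤ) - m - 1 else (i : ℤ) - m

/-- infix key of a word -/
def K (m : List ℕ → ℕ) : List ℕ → List ℕ → List ℤ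
  | _, [] => [0]
  | p, i :: u => code (m p) i :: K m (p ++ [i]) u

lemma code_ne (m i : ℕ) : code m i ≠ 0 := by unfold code; split_ifs <;> omega
lemma code_pos (m i : ℕ) : 0 < code m i ↔ m < i := by unfold code; split_ifs <;> omega
lemma code_neg (m i : ℕ) : code m i < 0 ↔ i ≤ m := by unfold code; split_ifs <;> omega
lemma code_lt (m i j : ℕ) : code m i < code m j ↔ i < j := by unfold code; split_ifs <;> omega
lemma code_inj (m i j : ℕ) : code m i = code m j ↔ i = j := by unfold code; split_ifs <;> omega

lemma K_inj (m : List ℕ → ℕ) (a : List ℕ) : ∀ (p b : List ℕ), K m p a = K m p b → a = b := by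
  induction a with
  | nil =>
    intro p b h
    cases b with
    | nil => rfl
    | cons j b =>
      simp only [K, List.cons.injEq] at h
      exact absurd h.1.symm (code_ne _ _)
  | cons i a ih =>
    intro p b h
    cases b with
    | nil =>
      simp only [K, List.cons.injEq] at h
      exact absurd h.1 (code_ne _ _)
    | cons j b =>
      simp only [K, List.cons.injEq, code_inj] at h
      obtain ⟨rfl, h⟩ := h
      rw [ih _ _ h]

lemma K_app (m : List ℕ → ℕ) (u x y : List ℕ) : ∀ p, K m p (u ++ x) < K m p (u ++ y) ↔
    K m (p ++ u) x < K m (p ++ u) y := by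
  induction u with
  | nil => intro p; simp
  | cons i u ih =>
    intro p
    simp only [List.cons_append, K, List.cons_lt_cons_iff, lt_irrefl, false_or, true_and]
    rw [ih]; simp

lemma K_side (m : List ℕ → ℕ) (u x y : List ℕ) : ∀ p w, ¬ u <+: w →
    (K m p w < K m p (u ++ x) ↔ K m p w < K m p (u ++ y)) := by
  induction u with
  | nil => intro p w h; exact absurd List.nil_prefix h
  | cons i u ih =>
    intro p w h
    cases w with
    | nil =>
      simp only [List.cons_append, K, List.cons_lt_cons_iff, (code_ne _ _).symm, false_and]
    | cons j w =>
      simp only [List.cons_append, K, List.cons_lt_cons_iff, code_inj]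
      by_cases hij : j = i
      · subst hij
        rw [List.cons_prefix_cons] at h
        rw [ih (p ++ [j]) w (fun h' => h ⟨rfl, h'⟩)]
      · simp [hij]

lemma K_child (m : List ℕ → ℕ) (u : List ℕ) (i : ℕ) :
    K m [] u < K m [] (u ++ [i]) ↔ m u < i := by
  have := K_app m u [] [i] []
  rw [List.append_nil] at this
  rw [this]
  simp only [K, List.nil_append, List.cons_lt_cons_iff, (code_ne _ _).symm, false_and, or_false,
    code_pos]

lemma K_sib (m : List ℕ → ℕ) (u : List ℕ) (i j : ℕ) :
    K m [] (u ++ [i]) < K m [] (u ++ [j]) ↔ i < j := by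
  rw [K_app]
  simp only [K, List.nil_append, List.cons_lt_cons_iff, code_lt, code_inj]
  constructor
  · rintro (h | ⟨rfl, h⟩)
    · exact h
    · exact absurd h (by simp)
  · exact Or.inl

/-! ### order determination -/

lemma kids {τ : PlaneTree} (u : List ℕ) : ∀ i, u ++ [i] ∈ τ.verts ↔ 1 ≤ i ∧ i ≤ τ.kc u := by
  have hfin : {i : ℕ | u ++ [i] ∈ τ.verts}.Finite := by
    apply Set.Finite.of_finite_image (f := fun i => u ++ [i])
    · apply τ.verts.finite_toSet.subset
      rintro _ ⟨i, hi, rfl⟩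
      exact hi
    · intro a _ b _ h; simpa using h
  intro i
  constructor
  · intro h
    refine ⟨τ.labels_pos _ h i (by simp), ?_⟩
    have : (Set.Icc 1 i) ⊆ {i : ℕ | u ++ [i] ∈ τ.verts} := by
      rintro j ⟨h1, h2⟩
      exact child_le τ u j i h1 h2 h
    have := Set.ncard_le_ncard this hfin
    unfold PlaneTree.kc
    rw [← Nat.card_coe_set_eq] at this
    simpa using this
  · rintro ⟨h1, h2⟩
    by_contra hc
    have : {i : ℕ | u ++ [i] ∈ τ.verts} ⊆ (Set.Ico 1 i) := by
      intro j hj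
      refine ⟨τ.labels_pos _ hj j (by simp), ?_⟩
      by_contra h
      push Not at h
      exact hc (child_le τ u i j h1 h hj)
    have := Set.ncard_le_ncard this (Set.finite_Ico _ _)
    unfold PlaneTree.kc at h2
    rw [← Nat.card_coe_set_eq (Set.Ico 1 i)] at this
    simp at this
    omega

lemma upper_count (L : Set ℕ) (k : ℕ) (h1 : L ⊆ Set.Icc 1 k)
    (h2 : ∀ i j, i ∈ L → i ≤ j → j ≤ k → j ∈ L) (i : ℕ) (hi1 : 1 ≤ i) (hi : i ≤ k) :
    i ∈ L ↔ k - L.ncard < i := by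
  have hfin : L.Finite := (Set.finite_Icc 1 k).subset h1
  constructor
  · intro h
    have : Set.Icc i k ⊆ L := fun j hj => h2 i j h hj.1 hj.2
    have := Set.ncard_le_ncard this hfin
    rw [← Nat.card_coe_set_eq (Set.Icc i k)] at this
    simp at this
    omega
  · intro h
    by_contra hc
    have : L ⊆ Set.Ioc i k := by
      intro j hj
      refine ⟨?_, (h1 hj).2⟩
      by_contra h'
      push Not at h'
      exact hc (h2 j i hj h' hi)
    have := Set.ncard_le_ncard this (Set.finite_Ioc _ _)
    rw [← Nat.card_coe_set_eq (Set.Ioc i k)] at this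
    simp at this
    omega

/-- strictly between -/
def betw {n : ℕ} (a b x : Fin n) : Prop := (a < x ∧ x < b) ∨ (b < x ∧ x < a)

lemma betw_edge {n : ℕ} (θ : NCTree n) (a b c d : Fin n) (hab : θ.adj.Adj a b)
    (hcd : θ.adj.Adj c d) (h : betw a b c) (h1 : d ≠ a) (h2 : d ≠ b) : betw a b d := by
  rcases h with ⟨h3, h4⟩ | ⟨h3, h4⟩
  · left
    refine ⟨?_, ?_⟩
    · by_contra hc
      exact no_interleave θ d c a b hcd.symm hab (lt_of_le_of_ne (not_lt.1 hc) h1) h3 h4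
    · by_contra hc
      exact no_interleave θ a b c d hab hcd h3 h4 (lt_of_le_of_ne (not_lt.1 hc) h2.symm)
  · right
    refine ⟨?_, ?_⟩
    · by_contra hc
      exact no_interleave θ d c b a hcd.symm hab.symm (lt_of_le_of_ne (not_lt.1 hc) h2) h3 h4
    · by_contra hc
      exact no_interleave θ b a c d hab.symm hcd h3 h4 (lt_of_le_of_ne (not_lt.1 hc) h1.symm)

section
variable {n : ℕ} {θ : NCTree n} {τ : PlaneTree} {f : List ℕ → Fin n}

lemma not_betw (hs : IsShape n θ τ f) (v : List ℕ) (j : ℕ) (hv : v ++ [j] ∈ τ.verts) (w : List ℕ) (hw : w ∈ τ.verts)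
    (h : ¬ v <+: w) : ¬ betw (f v) (f (v ++ [j])) (f w) := by
  obtain ⟨_, ⟨_, hinj, _⟩, h0, hadj, _, _⟩ := hs
  have hv' := app_mem _ _ _ hv
  induction w using List.reverseRecOn with
  | nil =>
    rintro (h' | h')
    · have := Fin.lt_def.1 h'.1; omega
    · have := Fin.lt_def.1 h'.1; omega
  | append_singleton w k ih =>
    have hw' := app_mem _ _ _ hw
    have hvw : ¬ v <+: w := fun h' => h (h'.trans (List.prefix_append _ _))
    intro hb
    have e1 := hadj _ hv (by simp)
    have e2 := hadj _ hw (by simp)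
    simp only [List.dropLast_concat] at e1 e2
    apply ih hw' hvw
    apply betw_edge θ _ _ _ _ e1 e2.symm hb
    · intro e
      exact hvw (by rw [hinj hw' hv' e])
    · intro e
      exact hvw (by rw [hinj hw' hv e]; exact List.prefix_append _ _)

lemma f_side (hs : IsShape n θ τ f) (v x u : List ℕ) (hu : u ∈ τ.verts) (hvx : v ++ x ∈ τ.verts) (h : ¬ v <+: u) :
    f (v ++ x) < f u ↔ f v < f u := by
  induction x using List.reverseRecOn with
  | nil => simp
  | append_singleton x j ih =>
    rw [← List.append_assoc] at hvx ⊢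
    have hx := app_mem _ _ _ hvx
    have hn : ¬ (v ++ x) <+: u := fun h' => h ((List.prefix_append _ _).trans h')
    have hb := not_betw hs (v ++ x) j hvx u hu hn
    rw [← ih hx]
    have n1 : f u ≠ f (v ++ x) := fun e => hn (by rw [hs.2.1.2.1 hu hx e])
    have n2 : f u ≠ f (v ++ x ++ [j]) := fun e =>
      hn (by rw [hs.2.1.2.1 hu hvx e]; exact List.prefix_append _ _)
    unfold betw at hb
    simp only [Fin.lt_def, ne_eq, Fin.ext_iff] at *
    omega

lemma f_side' (hs : IsShape n θ τ f) (v x u : List ℕ) (hu : u ∈ τ.verts) (hvx : v ++ x ∈ τ.verts) (h : ¬ v <+: u) :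
    f u < f (v ++ x) ↔ f u < f v := by
  have := f_side hs v x u hu hvx h
  have n1 : f u ≠ f v := fun e => h (by rw [hs.2.1.2.1 hu (app_mem _ _ _ hvx) e])
  have n2 : f u ≠ f (v ++ x) := fun e =>
      h (by rw [hs.2.1.2.1 hu hvx e]; exact List.prefix_append _ _)
  simp only [Fin.lt_def, ne_eq, Fin.ext_iff] at *
  omega

lemma not_pre_dl (u : List ℕ) (h : u ≠ []) : ¬ u <+: u.dropLast := by
  intro h'
  have := h'.length_le
  have := List.length_pos_iff.2 h
  simp at *
  omega

lemma f_sib (hs : IsShape n θ τ f) (u : List ℕ) (i j : ℕ) (hi : 1 ≤ i) (hij : i < j) (hj : u ++ [j] ∈ τ.verts) :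
    f (u ++ [i]) < f (u ++ [j]) := by
  have hi' := child_le τ u i j hi hij.le hj
  have hu := app_mem _ _ _ hj
  have := hs.2.2.2.2.2 u hu i j hi hij hj
  rwa [fin_sub_lt] at this
  by_cases h : u = []
  · subst h
    simp only [List.dropLast_nil, Fin.lt_def, hs.2.2.1]
    omega
  · have hd := dl_mem _ _ hu
    have hn := not_pre_dl u h
    rw [f_side hs u [i] _ hd hi' hn, f_side hs u [j] _ hd hj hn]

lemma f_key (hs : IsShape n θ τ f) (m : List ℕ → ℕ)
    (hm : ∀ p i, p ++ [i] ∈ τ.verts → (m p < i ↔ f p < f (p ++ [i]))) (a : List ℕ) :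
    ∀ p b, p ++ a ∈ τ.verts → p ++ b ∈ τ.verts → K m p a < K m p b → f (p ++ a) < f (p ++ b) := by
  have np : ∀ (p : List ℕ) (i j : ℕ) (b : List ℕ), i ≠ j → ¬ (p ++ [i]) <+: (p ++ j :: b) := by
    intro p i j b hij h
    rw [List.prefix_append_right_inj, List.cons_prefix_cons] at h
    exact hij h.1
  have np0 : ∀ (p : List ℕ) (i : ℕ), ¬ (p ++ [i]) <+: p := by
    intro p i h
    have := h.length_le
    simp at this
  induction a with
  | nil =>
    intro p b ha hb h
    cases b with
    | nil => exact absurd h (lt_irrefl _)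
    | cons j b =>
      simp only [K, List.cons_lt_cons_iff, (code_ne _ _).symm, false_and, or_false, code_pos] at h
      rw [List.append_nil] at ha ⊢
      rw [show p ++ j :: b = (p ++ [j]) ++ b by simp] at hb ⊢
      rw [f_side' hs _ _ _ ha hb (np0 _ _)]
      exact (hm p j (app_mem _ _ _ hb)).1 h
  | cons i a ih =>
    intro p b ha hb h
    have ha2 : (p ++ [i]) ++ a ∈ τ.verts := by simpa using ha
    cases b with
    | nil =>
      simp only [K, List.cons_lt_cons_iff, code_ne, false_and, or_false, code_neg] at h
      rw [List.append_nil] at hb ⊢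
      rw [show p ++ i :: a = (p ++ [i]) ++ a by simp]
      rw [f_side hs _ _ _ hb ha2 (np0 _ _)]
      have h1 := hm p i (app_mem _ _ _ ha2)
      have h2 : f p ≠ f (p ++ [i]) := by
        intro e
        have := hs.2.1.2.1 hb (app_mem _ _ _ ha2) e
        simp at this
      have : ¬ f p < f (p ++ [i]) := fun h' => by have := h1.2 h'; omega
      exact lt_of_le_of_ne (not_lt.1 this) h2.symm
    | cons j b =>
      have hb2 : (p ++ [j]) ++ b ∈ τ.verts := by simpa using hb
      simp only [K, List.cons_lt_cons_iff, code_lt, code_inj] at h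
      rcases h with h | ⟨rfl, h⟩
      · have s := f_sib hs p i j (τ.labels_pos _ (app_mem _ _ _ ha2) i (by simp)) h
          (app_mem _ _ _ hb2)
        have hb3 := hb
        rw [show p ++ i :: a = (p ++ [i]) ++ a by simp,
          f_side hs _ _ _ hb ha2 (np _ _ _ _ h.ne)]
        rw [show p ++ j :: b = (p ++ [j]) ++ b by simp,
          f_side' hs _ _ _ (app_mem _ _ _ ha2) hb2 (np p j i [] h.ne')]
        exact s
      · have := ih (p ++ [i]) b ha2 hb2 h
        simpa using this

lemma f_rk (hs : IsShape n θ τ f) (m : List ℕ → ℕ)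
    (hm : ∀ p i, p ++ [i] ∈ τ.verts → (m p < i ↔ f p < f (p ++ [i]))) (u : List ℕ)
    (hu : u ∈ τ.verts) : (f u).val = rk τ.verts (K m []) u := by
  classical
  have key := f_key hs m hm
  have key2 : ∀ a ∈ τ.verts, ∀ b ∈ τ.verts, K m [] a < K m [] b → f a < f b := by
    intro a ha b hb h
    exact key a [] b ha hb h
  have : (τ.verts.filter (fun v => K m [] v < K m [] u)).image f = Finset.Iio (f u) := by
    ext x
    simp only [Finset.mem_image, Finset.mem_filter, Finset.mem_Iio]
    constructor
    · rintro ⟨v, ⟨hv, h⟩, rfl⟩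
      exact key2 v hv u hu h
    · intro hx
      obtain ⟨v, hv, rfl⟩ := hs.2.1.2.2 (Set.mem_univ x)
      refine ⟨v, ⟨hv, ?_⟩, rfl⟩
      rcases lt_trichotomy (K m [] v) (K m [] u) with h | h | h
      · exact h
      · rw [K_inj m _ _ _ h] at hx; exact absurd hx (lt_irrefl _)
      · exact absurd hx (lt_asymm (key2 u hu v hv h))
  have h2 := congrArg Finset.card this
  rw [Fin.card_Iio, Finset.card_image_of_injOn] at h2
  · unfold rk; rw [← h2]; congr
  · intro a ha b hb hab
    simp only [Finset.coe_filter, Set.mem_setOf_eq] at ha hb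
    exact hs.2.1.2.1 ha.1 hb.1 hab

lemma f_pos (hs : IsShape n θ τ f) (u : List ℕ) (hu : u ∈ τ.verts) (hne : u ≠ []) : 0 < (f u).val := by
  rcases Nat.eq_zero_or_pos (f u).val with h | h
  · exact absurd (hs.2.1.2.1 hu τ.root_mem (Fin.ext (h.trans hs.2.2.1.symm))) hne
  · exact h

lemma left_iff (hs : IsShape n θ τ f) (u : List ℕ) (i : ℕ) (hu : u ++ [i] ∈ τ.verts) (hne : u ≠ []) :
    τ.kc u - leftCount n θ τ f u < i ↔ f u < f (u ++ [i]) := by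
  have hu0 := app_mem _ _ _ hu
  have hk := kids (τ := τ) u
  have e : ∀ i, i ∈ {i : ℕ | u ++ [i] ∈ τ.verts ∧ leftOf (ncPos n (f u)) (ncPos n (f (u ++ [i])))} ↔
      u ++ [i] ∈ τ.verts ∧ f u < f (u ++ [i]) := by
    intro i
    rw [Set.mem_setOf_eq, leftOf_iff n _ _ (f_pos hs u hu0 hne) (f u).2 (f _).2]
    rfl
  unfold leftCount
  rw [← upper_count _ (τ.kc u) _ _ i ((hk i).1 hu).1 ((hk i).1 hu).2, e]
  · simp [hu]
  · intro j hj
    rw [e] at hj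
    exact (hk j).1 hj.1
  · intro i j hi hij hj
    rw [e] at hi ⊢
    have hi1 := ((hk i).1 hi.1).1
    have hj' := (hk j).2 ⟨by omega, hj⟩
    refine ⟨hj', ?_⟩
    rcases hij.lt_or_eq with h | h
    · exact hi.2.trans (f_sib hs u i j hi1 h hj')
    · subst h; exact hi.2

open Classical in
lemma f_rk' (hs : IsShape n θ τ f) (ℓ : List ℕ → ℕ) (hℓ : ∀ u ∈ τ.verts, u ≠ [] → ℓ u = leftCount n θ τ f u)
    (u : List ℕ) (hu : u ∈ τ.verts) :
    (f u).val = rk τ.verts (K (fun u => if u = [] then 0 else τ.kc u - ℓ u) []) u := by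
  apply f_rk hs _ _ u hu
  intro p i hp
  by_cases h : p = []
  · subst h
    have := f_pos hs ([] ++ [i]) hp (by simp)
    have h1 := τ.labels_pos _ hp i (by simp)
    simp only [if_true, Fin.lt_def, hs.2.2.1]
    omega
  · simp only [h, if_false]
    rw [hℓ p (app_mem _ _ _ hp) h]
    exact left_iff hs p i hp h

lemma adj_char (hs : IsShape n θ τ f) (a b : Fin n) : θ.adj.Adj a b ↔ ∃ u i, u ++ [i] ∈ τ.verts ∧
    ((a = f u ∧ b = f (u ++ [i])) ∨ (b = f u ∧ a = f (u ++ [i]))) := by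
  have conc : ∀ u : List ℕ, u ≠ [] → ∃ i, u = u.dropLast ++ [i] := fun u hu =>
    ⟨_, (List.dropLast_append_getLast hu).symm⟩
  constructor
  · intro h
    obtain ⟨u, hu, rfl⟩ := hs.2.1.2.2 (Set.mem_univ a)
    obtain ⟨v, hv, rfl⟩ := hs.2.1.2.2 (Set.mem_univ b)
    rcases hs.2.2.2.2.1 u hu v hv h with e | e
    · have hne : v ≠ [] := by rintro rfl; simp at e; subst e; exact h.ne rfl
      obtain ⟨i, hi⟩ := conc v hne
      rw [← e] at hi
      subst hi
      exact ⟨u, i, hv, Or.inl ⟨rfl, rfl⟩⟩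
    · have hne : u ≠ [] := by rintro rfl; simp at e; subst e; exact h.ne rfl
      obtain ⟨i, hi⟩ := conc u hne
      rw [← e] at hi
      subst hi
      exact ⟨v, i, hu, Or.inr ⟨rfl, rfl⟩⟩
  · rintro ⟨u, i, hu, ⟨rfl, rfl⟩ | ⟨rfl, rfl⟩⟩
    · have := hs.2.2.2.1 _ hu (by simp)
      simpa using this
    · have := hs.2.2.2.1 _ hu (by simp)
      simpa using this.symm

end

lemma NCTree_ext {n : ℕ} (θ θ' : NCTree n) (h : θ.adj = θ'.adj) : θ = θ' := by
  cases θ; cases θ'; simp at h; subst h; rfl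

lemma theta_unique {n : ℕ} (θ θ' : NCTree n) (τ : PlaneTree) (f f' : List ℕ → Fin n)
    (hs : IsShape n θ τ f) (hs' : IsShape n θ' τ f')
    (h : ∀ u ∈ τ.verts, u ≠ [] → leftCount n θ τ f u = leftCount n θ' τ f' u) : θ = θ' := by
  have e : ∀ u ∈ τ.verts, f u = f' u := by
    intro u hu
    apply Fin.ext
    rw [f_rk' hs (leftCount n θ τ f) (fun _ _ _ => rfl) u hu, f_rk' hs' (leftCount n θ τ f) h u hu]
  apply NCTree_ext
  ext a b
  rw [adj_char hs, adj_char hs']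
  apply exists_congr; intro u
  apply exists_congr; intro i
  apply and_congr_right; intro hu
  rw [e _ hu, e _ (app_mem _ _ _ hu)]

end NCT
namespace NCT

section
variable {n : ℕ} {τ : PlaneTree} {f : List ℕ → Fin n} {m : List ℕ → ℕ}

lemma key_side (hf : ∀ u ∈ τ.verts, ∀ v ∈ τ.verts, (f u < f v ↔ K m [] u < K m [] v))
    (u : List ℕ) (i : ℕ) (hu : u ++ [i] ∈ τ.verts) (w : List ℕ)
    (hw : w ∈ τ.verts) (h : ¬ u <+: w) : f w < f (u ++ [i]) ↔ f w < f u := by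
  rw [hf _ hw _ hu, hf _ hw _ (app_mem _ _ _ hu)]
  have := K_side m u [i] [] [] w h
  rwa [List.append_nil] at this

/-- edge relation -/
def E (τ : PlaneTree) (f : List ℕ → Fin n) (a b : Fin n) : Prop :=
  ∃ u i, u ++ [i] ∈ τ.verts ∧ ((a = f u ∧ b = f (u ++ [i])) ∨ (b = f u ∧ a = f (u ++ [i])))

lemma E_symm (a b : Fin n) (h : E τ f a b) : E τ f b a := by
  obtain ⟨u, i, hu, h⟩ := h
  exact ⟨u, i, hu, h.symm⟩

lemma E_nc (hinj : Set.InjOn f (τ.verts : Set (List ℕ)))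
    (hf : ∀ u ∈ τ.verts, ∀ v ∈ τ.verts, (f u < f v ↔ K m [] u < K m [] v))
    (a b c d : Fin n) (hab : E τ f a b) (hcd : E τ f c d)
    (h1 : a < c) (h2 : c < b) (h3 : b < d) : False := by
  obtain ⟨u, i, hu, hab⟩ := hab
  obtain ⟨v, j, hv, hcd⟩ := hcd
  have hu' := app_mem _ _ _ hu
  have hv' := app_mem _ _ _ hv
  have p1 : u <+: v ++ [j] := by
    by_contra hc
    have hc' : ¬ u <+: v := fun h => hc (h.trans (List.prefix_append _ _))
    have s1 := key_side hf u i hu _ hv hc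
    have s2 := key_side hf u i hu _ hv' hc'
    rcases hab with ⟨rfl, rfl⟩ | ⟨rfl, rfl⟩ <;> rcases hcd with ⟨rfl, rfl⟩ | ⟨rfl, rfl⟩ <;>
    · simp only [Fin.lt_def] at *
      omega
  have p2 : v <+: u ++ [i] := by
    by_contra hc
    have hc' : ¬ v <+: u := fun h => hc (h.trans (List.prefix_append _ _))
    have s1 := key_side hf v j hv _ hu hc
    have s2 := key_side hf v j hv _ hu' hc'
    rcases hab with ⟨rfl, rfl⟩ | ⟨rfl, rfl⟩ <;> rcases hcd with ⟨rfl, rfl⟩ | ⟨rfl, rfl⟩ <;>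
    · simp only [Fin.lt_def] at *
      omega
  have fin : (f u = f (v ++ [j]) ∨ f v = f (u ++ [i]) ∨ f u = f v) → False := by
    simp only [Fin.ext_iff]
    intro h
    rcases hab with ⟨rfl, rfl⟩ | ⟨rfl, rfl⟩ <;> rcases hcd with ⟨rfl, rfl⟩ | ⟨rfl, rfl⟩ <;>
    · simp only [Fin.lt_def] at *
      omega
  apply fin
  rw [List.prefix_concat_iff] at p1 p2
  rcases p1 with p1 | p1
  · left; rw [p1]
  · rcases p2 with p2 | p2
    · right; left; rw [p2]
    · right; right; rw [p1.eq_of_length_le p2.length_le]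

/-- the graph -/
def graphOf (τ : PlaneTree) (f : List ℕ → Fin n)
    (hinj : Set.InjOn f (τ.verts : Set (List ℕ))) : SimpleGraph (Fin n) where
  Adj := E τ f
  symm := ⟨E_symm⟩
  loopless := ⟨by
    rintro a ⟨u, i, hu, h⟩
    have : f u = f (u ++ [i]) := by
      rcases h with ⟨h1, h2⟩ | ⟨h1, h2⟩ <;> rw [← h1, ← h2]
    have := hinj (app_mem _ _ _ hu) hu this
    simp at this⟩

lemma graphOf_tree (hinj : Set.InjOn f (τ.verts : Set (List ℕ))) (hcard : τ.verts.card = n)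
    (hsurj : ∀ a, ∃ u ∈ τ.verts, f u = a) : (graphOf τ f hinj).IsTree := by
  classical
  have hreach : ∀ u ∈ τ.verts, (graphOf τ f hinj).Reachable (f []) (f u) := by
    intro u
    induction u using List.reverseRecOn with
    | nil => intro _; exact SimpleGraph.Reachable.refl _
    | append_singleton w i ih =>
      intro hu
      refine (ih (app_mem _ _ _ hu)).trans (SimpleGraph.Adj.reachable ?_)
      exact ⟨w, i, hu, Or.inl ⟨rfl, rfl⟩⟩
  have hconn : (graphOf τ f hinj).Connected := by
    haveI : Nonempty (Fin n) := ⟨f []⟩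
    refine SimpleGraph.Connected.mk ?_
    intro a b
    obtain ⟨u, hu, rfl⟩ := hsurj a
    obtain ⟨v, hv, rfl⟩ := hsurj b
    exact (hreach u hu).symm.trans (hreach v hv)
  rw [SimpleGraph.isTree_iff_connected_and_card]
  refine ⟨hconn, le_antisymm ?_ hconn.card_vert_le_card_edgeSet_add_one⟩
  have hsub : (graphOf τ f hinj).edgeSet ⊆
      (((τ.verts.erase []).image (fun u => s(f u.dropLast, f u)) : Finset (Sym2 (Fin n))) :
        Set (Sym2 (Fin n))) := by
    intro e
    induction e using Sym2.ind with
    | _ a b =>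
      intro h
      rw [SimpleGraph.mem_edgeSet] at h
      obtain ⟨u, i, hu, h⟩ := h
      simp only [Finset.coe_image, Set.mem_image, Finset.mem_coe, Finset.mem_erase]
      refine ⟨u ++ [i], ⟨by simp, hu⟩, ?_⟩
      rw [List.dropLast_concat]
      rcases h with ⟨rfl, rfl⟩ | ⟨rfl, rfl⟩
      · rfl
      · exact Sym2.eq_swap
  have h1 := Set.ncard_le_ncard hsub (Finset.finite_toSet _)
  rw [Set.ncard_coe_finset] at h1
  have h2 := h1.trans Finset.card_image_le
  rw [Finset.card_erase_of_mem τ.root_mem, hcard, ← Nat.card_coe_set_eq] at h2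
  have : 0 < n := by rw [← hcard]; exact Finset.card_pos.2 ⟨_, τ.root_mem⟩
  simp only [Nat.card_eq_fintype_card (α := Fin n), Fintype.card_fin]
  omega

end

lemma theta_exists {n : ℕ} (τ : PlaneTree) (hcard : τ.verts.card = n) (ℓ : List ℕ → ℕ)
    (hℓ : ∀ u ∈ τ.verts, u ≠ [] → ℓ u ≤ τ.kc u) :
    ∃ (θ : NCTree n) (f : List ℕ → Fin n), IsShape n θ τ f ∧
      ∀ u ∈ τ.verts, u ≠ [] → ℓ u = leftCount n θ τ f u := by
  classical
  have hn : 0 < n := by rw [← hcard]; exact Finset.card_pos.2 ⟨_, τ.root_mem⟩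
  set m : List ℕ → ℕ := fun u => if u = [] then 0 else τ.kc u - ℓ u with hm
  obtain ⟨f, hfv⟩ : ∃ f : List ℕ → Fin n, ∀ u ∈ τ.verts, (f u).val = rk τ.verts (K m []) u := by
    refine ⟨fun u => if h : rk τ.verts (K m []) u < n then ⟨_, h⟩ else ⟨0, hn⟩, ?_⟩
    intro u hu
    have := rk_lt_card τ.verts (K m []) u hu
    rw [hcard] at this
    simp [this]
  have hf : ∀ u ∈ τ.verts, ∀ v ∈ τ.verts, (f u < f v ↔ K m [] u < K m [] v) := by
    intro u hu v hv
    rw [Fin.lt_def, hfv u hu, hfv v hv]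
    constructor
    · intro h
      by_contra hc
      have := rk_mono τ.verts (K m []) v u (not_lt.1 hc)
      omega
    · exact rk_lt _ _ _ _ hu
  have hinj : Set.InjOn f (τ.verts : Set (List ℕ)) := by
    intro a ha b hb hab
    have h1 := hf a ha b hb
    have h2 := hf b hb a ha
    rw [hab] at h1 h2
    simp only [lt_irrefl, false_iff, not_lt] at h1 h2
    exact K_inj m _ _ _ (le_antisymm h2 h1)
  have hsurj : ∀ a, ∃ u ∈ τ.verts, f u = a := by
    have : τ.verts.image f = Finset.univ := by
      apply Finset.eq_univ_of_card
      rw [Finset.card_image_of_injOn hinj, hcard, Fintype.card_fin]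
    intro a
    have h : a ∈ τ.verts.image f := by rw [this]; exact Finset.mem_univ _
    simpa using h
  have hchild : ∀ u i, u ++ [i] ∈ τ.verts → (f u < f (u ++ [i]) ↔ m u < i) := by
    intro u i hu
    rw [hf _ (app_mem _ _ _ hu) _ hu, K_child]
  have hroot : ∀ u ∈ τ.verts, ¬ f u < f [] := by
    intro u hu
    rw [hf _ hu _ τ.root_mem]
    cases u with
    | nil => exact lt_irrefl _
    | cons i u =>
      have : 1 ≤ i := τ.labels_pos _ hu i (by simp)
      simp only [K, List.cons_lt_cons_iff, code_ne, false_and, or_false, code_neg, hm, if_true]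
      omega
  have hf0 : (f []).val = 0 := by
    obtain ⟨u, hu, h⟩ := hsurj ⟨0, hn⟩
    have := hroot u hu
    rw [h, Fin.lt_def] at this
    simpa using this
  have nc : ∀ a b c d : Fin n, E τ f a b → E τ f c d → a < b → c < d →
      ({(a : ℕ), (b : ℕ)} : Set ℕ) ≠ {(c : ℕ), (d : ℕ)} →
      segment ℝ (ncPos n a) (ncPos n b) ∩ segment ℝ (ncPos n c) (ncPos n d) ⊆
      {z : ℂ | (z = ncPos n a ∨ z = ncPos n b) ∧ (z = ncPos n c ∨ z = ncPos n d)} := by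
    rintro a b c d hab hcd hlt hlt' hne z ⟨hz1, hz2⟩
    refine seg_inter n a b c d hlt b.2 c.2 d.2 hlt' ?_ ?_ ?_ z hz1 hz2
    · rintro ⟨e1, e2⟩; rw [e1, e2] at hne; exact hne rfl
    · rintro ⟨e1, e2, e3⟩; exact E_nc hinj hf a b c d hab hcd e1 e2 e3
    · rintro ⟨e1, e2, e3⟩; exact E_nc hinj hf c d a b hcd hab e1 e2 e3
  let θ : NCTree n :=
    { adj := graphOf τ f hinj
      isTree := graphOf_tree hinj hcard hsurj
      noncrossing := by
        intro a b c d hab hcd hne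
        have n1 := hab.ne
        have n2 := hcd.ne
        have hab : E τ f a b := hab
        have hcd : E τ f c d := hcd
        rcases lt_or_gt_of_ne n1 with h1 | h1 <;> rcases lt_or_gt_of_ne n2 with h2 | h2
        · exact nc a b c d hab hcd h1 h2 hne
        · rintro z ⟨hz1, hz2⟩
          rw [segment_symm] at hz2
          have := nc a b d c hab (E_symm _ _ hcd) h1 h2 (by rwa [Set.pair_comm (d : ℕ)]) ⟨hz1, hz2⟩
          exact ⟨this.1, this.2.symm⟩
        · rintro z ⟨hz1, hz2⟩
          rw [segment_symm] at hz1
          have := nc b a c d (E_symm _ _ hab) hcd h1 h2 (by rwa [Set.pair_comm (b : ℕ)]) ⟨hz1, hz2⟩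
          exact ⟨this.1.symm, this.2⟩
        · rintro z ⟨hz1, hz2⟩
          rw [segment_symm] at hz1 hz2
          have := nc b a d c (E_symm _ _ hab) (E_symm _ _ hcd) h1 h2
            (by rwa [Set.pair_comm (b : ℕ), Set.pair_comm (d : ℕ)]) ⟨hz1, hz2⟩
          exact ⟨this.1.symm, this.2.symm⟩ }
  have hs : IsShape n θ τ f := by
    refine ⟨hcard, ⟨fun _ _ => Set.mem_univ _, hinj, fun a _ => hsurj a⟩, hf0, ?_, ?_, ?_⟩
    · intro u hu hne
      refine ⟨u.dropLast, u.getLast hne, ?_, Or.inl ⟨rfl, ?_⟩⟩ <;>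
        rw [List.dropLast_append_getLast hne]
      exact hu
    · rintro u hu v hv ⟨w, i, hw, ⟨h1, h2⟩ | ⟨h1, h2⟩⟩
      · left
        rw [hinj hu (app_mem _ _ _ hw) h1, hinj hv hw h2]; simp
      · right
        rw [hinj hv (app_mem _ _ _ hw) h1, hinj hu hw h2]; simp
    · intro u hu i j hi hij hj
      have hi' := child_le τ u i j hi hij.le hj
      rw [fin_sub_lt, hf _ hi' _ hj, K_sib]
      · exact hij
      · have hd := dl_mem _ _ hu
        by_cases h : u = []
        · subst h
          simp only [List.dropLast_nil, hroot _ hi', hroot _ hj]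
        · have hn : ¬ u <+: u.dropLast := by
            intro h'
            have := h'.length_le
            have := List.length_pos_iff.2 h
            simp at *
            omega
          have s1 := key_side hf u i hi' _ hd hn
          have s2 := key_side hf u j hj _ hd hn
          have ne : ∀ k, u ++ [k] ∈ τ.verts → f (u ++ [k]) ≠ f u.dropLast := by
            intro k hk e
            apply hn
            rw [← hinj hk hd e]
            exact List.prefix_append _ _
          have n1 := ne i hi'
          have n2 := ne j hj
          simp only [Fin.lt_def, ne_eq, Fin.ext_iff] at *
          omega
  refine ⟨θ, f, hs, ?_⟩
  intro u hu hne
  unfold leftCount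
  have hk := kids (τ := τ) u
  have hmu : m u = τ.kc u - ℓ u := by simp [hm, hne]
  have hl := hℓ u hu hne
  have : {i : ℕ | u ++ [i] ∈ τ.verts ∧ leftOf (ncPos n (f u)) (ncPos n (f (u ++ [i])))} =
      Set.Ioc (m u) (τ.kc u) := by
    ext i
    change (u ++ [i] ∈ τ.verts ∧ leftOf (ncPos n (f u)) (ncPos n (f (u ++ [i])))) ↔ _
    rw [leftOf_iff n _ _ (f_pos hs u hu hne) (f u).2 (f _).2, Set.mem_Ioc]
    constructor
    · rintro ⟨h1, h2⟩
      exact ⟨(hchild u i h1).1 h2, ((hk i).1 h1).2⟩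
    · rintro ⟨h1, h2⟩
      have := (hk i).2 ⟨by omega, h2⟩
      exact ⟨this, (hchild u i this).2 h1⟩
  rw [this, ← Nat.card_coe_set_eq]
  simp
  omega

/-! ### lexicographic enumeration -/

lemma lex_mem (τ : PlaneTree) (j : ℕ) (hj : j < τ.verts.card) : τ.lexVertex j ∈ τ.verts := by
  unfold PlaneTree.lexVertex
  rw [List.getD_eq_getElem _ _ (by rwa [Finset.length_sort]), ← Finset.mem_sort (· ≤ ·)]
  exact List.getElem_mem _

lemma lex_inj (τ : PlaneTree) (i j : ℕ) (hi : i < τ.verts.card) (hj : j < τ.verts.card)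
    (h : τ.lexVertex i = τ.lexVertex j) : i = j := by
  unfold PlaneTree.lexVertex at h
  rw [List.getD_eq_getElem _ _ (by rwa [Finset.length_sort]),
    List.getD_eq_getElem _ _ (by rwa [Finset.length_sort])] at h
  exact (List.Nodup.getElem_inj_iff (Finset.sort_nodup _ _)).1 h

lemma lex_surj (τ : PlaneTree) (u : List ℕ) (hu : u ∈ τ.verts) :
    ∃ j, j < τ.verts.card ∧ τ.lexVertex j = u := by
  rw [← Finset.mem_sort (· ≤ ·)] at hu
  obtain ⟨j, hj, e⟩ := List.getElem_of_mem hu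
  refine ⟨j, by rwa [Finset.length_sort] at hj, ?_⟩
  unfold PlaneTree.lexVertex
  rw [List.getD_eq_getElem _ _ hj, e]

lemma lex_zero (τ : PlaneTree) : τ.lexVertex 0 = [] := by
  obtain ⟨j, hj, e⟩ := lex_surj τ [] τ.root_mem
  rcases Nat.eq_zero_or_pos j with h | h
  · rwa [h] at e
  · have hs := Finset.pairwise_sort τ.verts (· ≤ ·)
    rw [List.pairwise_iff_getElem] at hs
    have h0 : 0 < (τ.verts.sort (· ≤ ·)).length := by rw [Finset.length_sort]; omega
    have hj' : j < (τ.verts.sort (· ≤ ·)).length := by rwa [Finset.length_sort]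
    have := hs 0 j h0 hj' h
    unfold PlaneTree.lexVertex at e ⊢
    rw [List.getD_eq_getElem _ _ hj'] at e
    rw [List.getD_eq_getElem _ _ h0]
    rw [e] at this
    by_contra hne
    obtain ⟨x, l, hl⟩ := List.exists_cons_of_ne_nil hne
    rw [hl] at this
    exact absurd (List.nil_lt_cons x l) (not_lt.2 this)

lemma lex_surj' (τ : PlaneTree) (u : List ℕ) (hu : u ∈ τ.verts) (hne : u ≠ []) :
    ∃ j, 1 ≤ j ∧ j < τ.verts.card ∧ τ.lexVertex j = u := by
  obtain ⟨j, hj, e⟩ := lex_surj τ u hu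
  refine ⟨j, ?_, hj, e⟩
  rcases Nat.eq_zero_or_pos j with h | h
  · subst h; rw [lex_zero] at e; exact absurd e.symm hne
  · exact h

lemma lex_ne (τ : PlaneTree) (j : ℕ) (h1 : 1 ≤ j) (hj : j < τ.verts.card) :
    τ.lexVertex j ≠ [] := by
  intro e
  rw [← lex_zero τ] at e
  have := lex_inj τ _ _ hj (by omega) e
  omega

lemma left_le {n : ℕ} (θ : NCTree n) (τ : PlaneTree) (f : List ℕ → Fin n) (u : List ℕ) :
    leftCount n θ τ f u ≤ τ.kc u := by
  refine Set.ncard_le_ncard (fun i hi => hi.1) ?_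
  apply (Set.finite_Icc 1 (τ.kc u)).subset
  intro i hi
  exact (kids u i).1 hi

lemma left_congr {n : ℕ} (θ : NCTree n) (τ : PlaneTree) (f f' : List ℕ → Fin n) (u : List ℕ)
    (hu : u ∈ τ.verts) (h : ∀ u ∈ τ.verts, f u = f' u) :
    leftCount n θ τ f u = leftCount n θ τ f' u := by
  unfold leftCount
  congr 1
  ext i
  apply and_congr_right
  intro hi
  rw [h _ hi, h _ hu]

end NCT

/-- For every `n ≥ 1`, the map `Φ_n : θ ↦ (S(θ), C(θ))` sending a noncrossing
tree with `n` vertices to its shape together with its sequence of left-children counts is a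
bijection from `NC_n` onto the set `T_n^dec` of decorated plane trees with `n` vertices:
every noncrossing tree corresponds to exactly one decorated tree, and every decorated tree to
exactly one noncrossing tree. -/
theorem ncTree_decoratedTree_bijection (n : ℕ) (hn : 1 ≤ n) :
    (∀ θ : NCTree n, ∃! d : PlaneTree × (ℕ → ℕ), DecOK n d.1 d.2 ∧ ShapeDec n θ d.1 d.2) ∧
    (∀ d : PlaneTree × (ℕ → ℕ), DecOK n d.1 d.2 →
      ∃! θ : NCTree n, ShapeDec n θ d.1 d.2) := by
  haveI : NeZero n := ⟨by omega⟩
  constructor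
  · intro θ
    obtain ⟨τ, f, hs⟩ := NCT.shape_exists θ
    have hcard := hs.1
    refine ⟨(τ, fun j => if 1 ≤ j ∧ j < n then leftCount n θ τ f (τ.lexVertex j) else 0),
      ⟨⟨hcard, ?_, ?_⟩, f, hs, ?_, ?_⟩, ?_⟩
    · intro j h1 h2
      simp only [h1, h2, and_self, if_true]
      exact NCT.left_le _ _ _ _
    · intro j hj
      simp only
      rw [if_neg (by omega)]
    · intro j h1 h2
      simp only [h1, h2, and_self, if_true]
    · intro j hj
      simp only
      rw [if_neg (by omega)]
    · rintro ⟨τ', c'⟩ ⟨_, f', hs', h1, h2⟩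
      obtain ⟨e, hf⟩ := NCT.shape_unique θ τ τ' f f' hs hs'
      subst e
      refine Prod.ext rfl ?_
      funext j
      simp only at h1 h2 ⊢
      split_ifs with hj
      · rw [h1 j hj.1 hj.2]
        exact (NCT.left_congr θ τ f f' _ (NCT.lex_mem τ j (by omega)) hf).symm
      · exact h2 j (by omega)
  · rintro ⟨τ, c⟩ ⟨hcard, hc, hc0⟩
    simp only at hcard hc hc0 ⊢
    have hex : ∀ u, ∃ j, u ∈ τ.verts → u ≠ [] →
        1 ≤ j ∧ j < τ.verts.card ∧ τ.lexVertex j = u := by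
      intro u
      by_cases h : u ∈ τ.verts ∧ u ≠ []
      · obtain ⟨j, hj⟩ := NCT.lex_surj' τ u h.1 h.2
        exact ⟨j, fun _ _ => hj⟩
      · exact ⟨0, fun h1 h2 => absurd ⟨h1, h2⟩ h⟩
    choose g hg using hex
    obtain ⟨θ, f, hs, hl⟩ := NCT.theta_exists τ hcard (fun u => c (g u)) (by
      intro u hu hne
      obtain ⟨h1, h2, h3⟩ := hg u hu hne
      have := hc (g u) h1 (by omega)
      rwa [h3] at this)
    refine ⟨θ, ⟨f, hs, ?_, hc0⟩, ?_⟩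
    · intro j h1 h2
      have hm := NCT.lex_mem τ j (by omega)
      have hne := NCT.lex_ne τ j h1 (by omega)
      rw [← hl _ hm hne]
      obtain ⟨_, h4, h5⟩ := hg _ hm hne
      rw [NCT.lex_inj τ _ _ h4 (by omega) h5]
    · rintro θ' ⟨f', hs', h1, _⟩
      apply NCT.theta_unique θ' θ τ f' f hs' hs
      intro u hu hne
      rw [← hl u hu hne]
      obtain ⟨h3, h4, h5⟩ := hg u hu hne
      have := h1 (g u) h3 (by omega)
      rw [h5] at this
      exact this.symm
end

section
/- For every n ≥ 1 and every plane tree τ with n vertices, the number of noncrossing trees with n vertices whose shape equals τ is ∏_{u ∈ τ∖{∅}} (k_u(τ) + 1). -/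
open Filter Set

/-! ### Geometry of chords of the regular polygon -/

lemma nc_re (n k : ℕ) : (ncPos n k).re = Real.cos (2 * (Real.pi * k / n)) := by
  have : ncPos n k = Complex.exp (((-(2 * (Real.pi * k / n)) : ℝ) : ℂ) * Complex.I) := by
    unfold ncPos; congr 1; push_cast; ring
  rw [this, Complex.exp_ofReal_mul_I_re, Real.cos_neg]

lemma nc_im (n k : ℕ) : (ncPos n k).im = -Real.sin (2 * (Real.pi * k / n)) := by
  have : ncPos n k = Complex.exp (((-(2 * (Real.pi * k / n)) : ℝ) : ℂ) * Complex.I) := by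
    unfold ncPos; congr 1; push_cast; ring
  rw [this, Complex.exp_ofReal_mul_I_im, Real.sin_neg]

/-- Twice the (clockwise) signed area of a triangle. -/
def ncArea (z w v : ℂ) : ℝ :=
  (w.im - z.im) * (v.re - z.re) - (w.re - z.re) * (v.im - z.im)

lemma area_formula (n a b c : ℕ) : ncArea (ncPos n a) (ncPos n b) (ncPos n c) =
    4 * Real.sin (Real.pi * b / n - Real.pi * a / n) * Real.sin (Real.pi * c / n - Real.pi * b / n)
      * Real.sin (Real.pi * c / n - Real.pi * a / n) := by
  unfold ncArea
  simp only [nc_re, nc_im]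
  generalize Real.pi * a / n = x
  generalize Real.pi * b / n = y
  generalize Real.pi * c / n = z
  have h1 : Real.cos (2 * y) - Real.cos (2 * x) = -2 * Real.sin (y + x) * Real.sin (y - x) := by
    rw [Real.cos_sub_cos]; congr 3 <;> ring
  have h2 : Real.cos (2 * z) - Real.cos (2 * x) = -2 * Real.sin (z + x) * Real.sin (z - x) := by
    rw [Real.cos_sub_cos]; congr 3 <;> ring
  have h3 : Real.sin (2 * y) - Real.sin (2 * x) = 2 * Real.sin (y - x) * Real.cos (y + x) := by
    rw [Real.sin_sub_sin]; congr 3 <;> ring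
  have h4 : Real.sin (2 * z) - Real.sin (2 * x) = 2 * Real.sin (z - x) * Real.cos (z + x) := by
    rw [Real.sin_sub_sin]; congr 3 <;> ring
  have h5 : Real.sin (z - y) = Real.sin (z + x) * Real.cos (y + x)
      - Real.cos (z + x) * Real.sin (y + x) := by
    rw [← Real.sin_sub]; congr 1; ring
  rw [h1, h2, h5]
  linear_combination (2 * Real.sin (z + x) * Real.sin (z - x)) * h3
    - (2 * Real.sin (y + x) * Real.sin (y - x)) * h4

lemma sin_pos_aux {n a b : ℕ} (hab : a < b) (hb : b < n) :
    0 < Real.sin (Real.pi * b / n - Real.pi * a / n) := by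
  have hn : (0 : ℝ) < n := by exact_mod_cast (by omega : 0 < n)
  have h1 : (a : ℝ) < b := by exact_mod_cast hab
  have h2 : (b : ℝ) - a < n := by
    have : (b : ℝ) < n := by exact_mod_cast hb
    have : (0 : ℝ) ≤ a := by positivity
    linarith
  have e : Real.pi * b / n - Real.pi * a / n = Real.pi * ((b - a) / n) := by ring
  rw [e]
  apply Real.sin_pos_of_pos_of_lt_pi
  · have := Real.pi_pos
    have : (0 : ℝ) < b - a := by linarith
    positivity
  · have : ((b : ℝ) - a) / n < 1 := by rw [div_lt_one hn]; exact h2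
    nlinarith [Real.pi_pos]

lemma area_pos {n a b c : ℕ} (hab : a < b) (hbc : b < c) (hc : c < n) :
    0 < ncArea (ncPos n a) (ncPos n b) (ncPos n c) := by
  rw [area_formula]
  have h1 := sin_pos_aux hab (hbc.trans hc)
  have h2 := sin_pos_aux hbc hc
  have h3 := sin_pos_aux (hab.trans hbc) hc
  positivity

lemma area_rot (z w v : ℂ) : ncArea w v z = ncArea z w v := by unfold ncArea; ring
lemma area_swap (z w v : ℂ) : ncArea z v w = - ncArea z w v := by unfold ncArea; ring

/-- Outside the chord. -/
lemma area_out {n a b c : ℕ} (hab : a < b) (hb : b < n) (hc : c < n) (h : c < a ∨ b < c) :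
    0 < ncArea (ncPos n a) (ncPos n b) (ncPos n c) := by
  rcases h with h | h
  · rw [← area_rot, ← area_rot]; exact area_pos h hab hb
  · exact area_pos hab h hc

/-- Under the chord. -/
lemma area_in {n a b c : ℕ} (hb : b < n) (h1 : a < c) (h2 : c < b) :
    ncArea (ncPos n a) (ncPos n b) (ncPos n c) < 0 := by
  rw [area_swap]
  have := area_pos h1 h2 hb
  linarith

lemma area_self (z w : ℂ) : ncArea z w z = 0 ∧ ncArea z w w = 0 ∧ ncArea z z w = 0 := by
  unfold ncArea; refine ⟨?_, ?_, ?_⟩ <;> ring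

lemma nc_inj {n a b : ℕ} (ha : a < n) (hb : b < n) (h : ncPos n a = ncPos n b) : a = b := by
  -- two distinct vertices have distinct positions
  by_contra hne
  wlog hab : a < b generalizing a b
  · exact this hb ha h.symm (Ne.symm hne) (by omega)
  have h1 := sin_pos_aux hab hb
  have e1 := congrArg Complex.re h
  have e2 := congrArg Complex.im h
  rw [nc_re, nc_re] at e1
  rw [nc_im, nc_im] at e2
  have hc : Real.cos (2 * (Real.pi * b / n - Real.pi * a / n)) = 1 := by
    rw [mul_sub, Real.cos_sub]
    have := Real.sin_sq_add_cos_sq (2 * (Real.pi * b / n))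
    rw [e1, neg_inj.mp e2]; nlinarith
  rw [Real.cos_two_mul] at hc
  have := Real.sin_sq_add_cos_sq (Real.pi * b / n - Real.pi * a / n)
  nlinarith

lemma area_segment {z w : ℂ} {s t : ℝ} (hst : s + t = 1) (a b : ℂ) :
    ncArea a b (s • z + t • w) = s * ncArea a b z + t * ncArea a b w := by
  unfold ncArea
  simp
  have : s = 1 - t := by linarith
  subst this; ring

/-- Interleaved chords meet at a point which is not a common endpoint. -/
lemma crossing_aux {n a b c d : ℕ} (hac : a < c) (hcb : c < b) (hbd : b < d) (hd : d < n)
    (h : segment ℝ (ncPos n a) (ncPos n b) ∩ segment ℝ (ncPos n c) (ncPos n d) ⊆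
      {z : ℂ | (z = ncPos n a ∨ z = ncPos n b) ∧ (z = ncPos n c ∨ z = ncPos n d)}) : False := by
  -- barycentric weights
  have h1 := area_pos hcb hbd hd
  have h2 := area_pos hac (hcb.trans hbd) hd
  have h3 := area_pos (hac.trans hcb) hbd hd
  have h4 := area_pos hac hcb (hbd.trans hd)
  set A := ncPos n a with hA
  set B := ncPos n b with hB
  set C := ncPos n c with hC
  set D := ncPos n d with hD
  have hsum : ncArea C B D + ncArea A C D = ncArea A B D + ncArea A C B := by
    unfold ncArea; ring
  set S := ncArea C B D + ncArea A C D with hS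
  have hSpos : 0 < S := by positivity
  have hz : (ncArea C B D / S) • A + (ncArea A C D / S) • B
      = (ncArea A B D / S) • C + (ncArea A C B / S) • D := by
    apply Complex.ext
    · simp
      field_simp
      unfold ncArea; ring
    · simp
      field_simp
      unfold ncArea; ring
  have hm := @h ((ncArea C B D / S) • A + (ncArea A C D / S) • B) ⟨
    ⟨_, _, by positivity, by positivity, by rw [← add_div, ← hS, div_self hSpos.ne'], rfl⟩, by
    rw [hz]
    exact ⟨_, _, by positivity, by positivity, by rw [← add_div, ← hsum, div_self hSpos.ne'], rfl⟩⟩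
  obtain ⟨p, q⟩ := hm
  rcases p with p | p <;> rcases q with q | q <;> rw [p] at q <;>
    have := nc_inj (by omega) (by omega) q <;> omega

/-- Chords which are not interleaved meet only at common endpoints. -/
lemma noncrossing_aux {n a b c d : ℕ} (hab : a < b) (hb : b < n) (hc : c < n) (hd : d < n)
    (hcd : c ≠ d)
    (hne : ¬ (c = a ∧ d = b) ∧ ¬ (c = b ∧ d = a))
    (h1 : ¬ ((a < c ∧ c < b) ∧ (d < a ∨ b < d))) (h2 : ¬ ((a < d ∧ d < b) ∧ (c < a ∨ b < c))) :
    segment ℝ (ncPos n a) (ncPos n b) ∩ segment ℝ (ncPos n c) (ncPos n d) ⊆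
      {z : ℂ | (z = ncPos n a ∨ z = ncPos n b) ∧ (z = ncPos n c ∨ z = ncPos n d)} := by
  rintro z ⟨⟨s, t, hs, ht, hst, rfl⟩, ⟨s', t', hs', ht', hst', hz⟩⟩
  have hA : ncArea (ncPos n a) (ncPos n b) (s • ncPos n a + t • ncPos n b) = 0 := by
    rw [area_segment hst]; simp [area_self]
  rw [← hz] at hA ⊢
  have hA' := hA
  rw [area_segment hst'] at hA
  -- the signed areas of `c` and `d`
  have key : (c ≠ a ∧ c ≠ b → s' = 0) ∧ (d ≠ a ∧ d ≠ b → t' = 0) := by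
    have tri : ∀ e, e < n → ((a < e ∧ e < b) ∧ ncArea (ncPos n a) (ncPos n b) (ncPos n e) < 0) ∨
        ((e < a ∨ b < e) ∧ 0 < ncArea (ncPos n a) (ncPos n b) (ncPos n e)) ∨
        ((e = a ∨ e = b) ∧ ncArea (ncPos n a) (ncPos n b) (ncPos n e) = 0) := by
      intro e he
      rcases lt_trichotomy e a with h | h | h
      · exact Or.inr (Or.inl ⟨Or.inl h, area_out hab hb he (Or.inl h)⟩)
      · subst h; exact Or.inr (Or.inr ⟨Or.inl rfl, (area_self _ _).1⟩)
      · rcases lt_trichotomy e b with h' | h' | h'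
        · exact Or.inl ⟨⟨h, h'⟩, area_in hb h h'⟩
        · subst h'; exact Or.inr (Or.inr ⟨Or.inr rfl, (area_self _ _).2.1⟩)
        · exact Or.inr (Or.inl ⟨Or.inr h', area_out hab hb he (Or.inr h')⟩)
    have tc := tri c hc
    have td := tri d hd
    generalize ncArea (ncPos n a) (ncPos n b) (ncPos n c) = X at *
    generalize ncArea (ncPos n a) (ncPos n b) (ncPos n d) = Y at *
    rcases tc with ⟨c1, c2⟩ | ⟨c1, c2⟩ | ⟨c1, c2⟩ <;> rcases td with ⟨d1, d2⟩ | ⟨d1, d2⟩ | ⟨d1, d2⟩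
    · constructor <;> intro _ <;> nlinarith
    · exact absurd ⟨c1, d1⟩ h1
    · refine ⟨fun _ => ?_, fun h => by omega⟩
      rw [d2] at hA; nlinarith
    · exact absurd ⟨d1, c1⟩ h2
    · constructor <;> intro _ <;> nlinarith
    · refine ⟨fun _ => ?_, fun h => by omega⟩
      rw [d2] at hA; nlinarith
    · refine ⟨fun h => by omega, fun _ => ?_⟩
      rw [c2] at hA; nlinarith
    · refine ⟨fun h => by omega, fun _ => ?_⟩
      rw [c2] at hA; nlinarith
    · constructor <;> intro _ <;> omega
  by_cases hca : c ≠ a ∧ c ≠ b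
  · have h0 := key.1 hca
    have h1' : t' = 1 := by linarith
    by_cases hda : d ≠ a ∧ d ≠ b
    · have := key.2 hda; linarith
    · have : d = a ∨ d = b := by omega
      simp only [h0, h1', zero_smul, one_smul, zero_add, Set.mem_setOf_eq]
      refine ⟨?_, Or.inr trivial⟩
      rcases this with rfl | rfl <;> simp
  · have hd' : d ≠ a ∧ d ≠ b := by omega
    have h0 := key.2 hd'
    have h1' : s' = 1 := by linarith
    have : c = a ∨ c = b := by omega
    simp only [h0, h1', zero_smul, one_smul, add_zero, Set.mem_setOf_eq]
    refine ⟨?_, Or.inl trivial⟩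
    rcases this with rfl | rfl <;> simp

/-! ### Combinatorics -/

lemma nc_no_cross {n : ℕ} (θ : NCTree n) {a b c d : Fin n} (hab : θ.adj.Adj a b)
    (hcd : θ.adj.Adj c d) (h1 : a < c) (h2 : c < b) (h3 : b < d) : False := by
  refine crossing_aux (n := n) h1 h2 h3 d.2 (θ.noncrossing a b c d hab hcd ?_)
  intro h
  have : (a : ℕ) ∈ ({(c : ℕ), (d : ℕ)} : Set ℕ) := by rw [← h]; simp
  have h1' : (a : ℕ) < c := h1
  have h2' : (c : ℕ) < b := h2
  have h3' : (b : ℕ) < d := h3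
  simp only [Set.mem_insert_iff, Set.mem_singleton_iff] at this
  omega

/-- The combinatorial description of the labellings arising from noncrossing trees. -/
structure GoodLab (n : ℕ) (τ : PlaneTree) (f : List ℕ → Fin n) : Prop where
  bij : Set.BijOn f (↑τ.verts) Set.univ
  root : (f ([] : List ℕ)).val = 0
  interval : ∀ u x y z : List ℕ, x ∈ τ.verts → y ∈ τ.verts → z ∈ τ.verts →
    u <+: x → u <+: z → f x < f y → f y < f z → u <+: y
  incr : ∀ (u : List ℕ) (i j : ℕ), 1 ≤ i → i < j → u ++ [i] ∈ τ.verts → u ++ [j] ∈ τ.verts →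
    f (u ++ [i]) < f (u ++ [j])

lemma initial_seg (T : Set ℕ) (hT : T.Finite) (h1 : ∀ i ∈ T, 1 ≤ i)
    (h2 : ∀ i, 1 ≤ i → i + 1 ∈ T → i ∈ T) (i : ℕ) : i ∈ T ↔ 1 ≤ i ∧ i ≤ T.ncard := by
  have down : ∀ d i, 1 ≤ i → i + d ∈ T → i ∈ T := by
    intro d
    induction d with
    | zero => intro i _ h; simpa using h
    | succ d ih =>
      intro i hi h
      exact h2 i hi (ih (i + 1) (by omega) (by rwa [show i + 1 + d = i + (d + 1) by ring]))
  obtain ⟨m, hm⟩ : ∃ m, T = Set.Icc 1 m := by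
    by_cases hne : T.Nonempty
    · obtain ⟨m, hm, hmax⟩ := Set.exists_max_image T id hT hne
      refine ⟨m, Set.Subset.antisymm (fun i hi => ⟨h1 i hi, hmax i hi⟩) fun i hi => ?_⟩
      exact down (m - i) i hi.1 (by rwa [Nat.add_sub_cancel' hi.2])
    · rw [Set.not_nonempty_iff_eq_empty] at hne
      exact ⟨0, by simp [hne]⟩
  have : T.ncard = m := by
    rw [hm, ← Finset.coe_Icc, Set.ncard_coe_finset]; simp
  rw [this, hm]; rfl

namespace PlaneTree

variable (τ : PlaneTree)

lemma fin_children (u : List ℕ) : {i : ℕ | u ++ [i] ∈ τ.verts}.Finite := by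
  apply Set.Finite.preimage (f := fun i : ℕ => u ++ [i]) _ τ.verts.finite_toSet
  intro a _ b _ h
  simpa using h

lemma label_pos {u : List ℕ} {i : ℕ} (h : u ++ [i] ∈ τ.verts) : 1 ≤ i :=
  τ.labels_pos _ h i (by simp)

lemma mem_children (u : List ℕ) (i : ℕ) : u ++ [i] ∈ τ.verts ↔ 1 ≤ i ∧ i ≤ τ.kc u :=
  initial_seg {i : ℕ | u ++ [i] ∈ τ.verts} (τ.fin_children u) (fun _ h => τ.label_pos h)
    (fun i hi h => τ.children_closed u i hi h) i

lemma parent_mem {u v : List ℕ} (h : u ++ v ∈ τ.verts) : u ∈ τ.verts :=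
  τ.prefix_closed _ _ (List.prefix_append u v) h

end PlaneTree

lemma fin_sub_lt {n : ℕ} (a b p : Fin n) (h : (p ≤ a ∧ p ≤ b) ∨ (a < p ∧ b < p)) :
    a - p < b - p ↔ a < b := by
  have key : ∀ a : Fin n, ((a - p : Fin n) : ℕ) = if p ≤ a then (a : ℕ) - p else n + a - p := by
    intro a
    rw [Fin.sub_def]
    have := a.2
    have := p.2
    simp only [Fin.le_def]
    split_ifs with h
    · rw [show n - (p : ℕ) + a = (a - p) + n by omega, Nat.add_mod_right, Nat.mod_eq_of_lt (by omega)]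
    · rw [Nat.mod_eq_of_lt (by omega)]; omega
  have := a.2
  have := b.2
  have := p.2
  simp only [Fin.lt_def, Fin.le_def] at *
  rw [key, key]
  rcases h with h | h
  · rw [if_pos h.1, if_pos h.2]; omega
  · rw [if_neg (by omega), if_neg (by omega)]; omega

lemma prefix_concat {u l : List ℕ} {i : ℕ} : u <+: l ++ [i] ↔ u = l ++ [i] ∨ u <+: l :=
  List.prefix_concat_iff

lemma not_concat_pre {l : List ℕ} {i : ℕ} (t : List ℕ) : ¬ (l ++ i :: t) <+: l := by
  intro h
  have := h.length_le
  simp at this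

lemma GoodLab.ne {n : ℕ} {τ : PlaneTree} {f : List ℕ → Fin n} (hf : GoodLab n τ f)
    {u v : List ℕ} (hu : u ∈ τ.verts) (hv : v ∈ τ.verts) (h : u ≠ v) : f u ≠ f v :=
  fun e => h (hf.bij.injOn hu hv e)

/-- The order condition in the definition of the shape, for a labelling with interval subtrees. -/
lemma order_iff {n : ℕ} {τ : PlaneTree} {f : List ℕ → Fin n}
    (inj : Set.InjOn f ↑τ.verts)
    (root : (f ([] : List ℕ)).val = 0)
    (interval : ∀ u x y z : List ℕ, x ∈ τ.verts → y ∈ τ.verts → z ∈ τ.verts →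
      u <+: x → u <+: z → f x < f y → f y < f z → u <+: y)
    (u : List ℕ) (i j : ℕ) (hi : u ++ [i] ∈ τ.verts) (hj : u ++ [j] ∈ τ.verts) :
    f (u ++ [i]) - f u.dropLast < f (u ++ [j]) - f u.dropLast ↔ f (u ++ [i]) < f (u ++ [j]) := by
  apply fin_sub_lt
  rcases List.eq_nil_or_concat u with rfl | ⟨l, k, rfl⟩
  · left
    simp only [List.dropLast_nil, Fin.le_def, root]
    omega
  · simp only [List.concat_eq_append, List.dropLast_concat] at *
    have hlk := τ.parent_mem hi
    have hl := τ.parent_mem hlk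
    have hnp : ¬ (l ++ [k]) <+: l := not_concat_pre []
    have n1 : f (l ++ [k] ++ [i]) ≠ f l := fun e => by
      have := congrArg List.length (inj hi hl e)
      simp at this
    have n2 : f (l ++ [k] ++ [j]) ≠ f l := fun e => by
      have := congrArg List.length (inj hj hl e)
      simp at this
    have i1 := fun h1 h2 => hnp (interval (l ++ [k]) _ _ _ hi hl hj
      (List.prefix_append _ _) (List.prefix_append _ _) h1 h2)
    have i2 := fun h1 h2 => hnp (interval (l ++ [k]) _ _ _ hj hl hi
      (List.prefix_append _ _) (List.prefix_append _ _) h1 h2)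
    rcases lt_or_gt_of_ne n1 with h1 | h1 <;> rcases lt_or_gt_of_ne n2 with h2 | h2
    · exact Or.inr ⟨h1, h2⟩
    · exact (i1 h1 h2).elim
    · exact (i2 h2 h1).elim
    · exact Or.inl ⟨h1.le, h2.le⟩

lemma shape_interval {n : ℕ} {θ : NCTree n} {τ : PlaneTree} {f : List ℕ → Fin n}
    (h : IsShape n θ τ f) (u x y z : List ℕ) (hx : x ∈ τ.verts) (hy : y ∈ τ.verts)
    (hz : z ∈ τ.verts) (hux : u <+: x) (huz : u <+: z) (hxy : f x < f y) (hyz : f y < f z) :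
    u <+: y := by
  obtain ⟨-, bij, root, adj, -, -⟩ := h
  have adj' : ∀ l i, l ++ [i] ∈ τ.verts → θ.adj.Adj (f l) (f (l ++ [i])) := by
    intro l i hl
    have := adj _ hl (by simp)
    rwa [List.dropLast_concat] at this
  by_contra huy
  -- an edge of the subtree straddling `y`
  have A : ∃ l i, l ++ [i] ∈ τ.verts ∧ u <+: l ∧
      ((f l < f y ∧ f y < f (l ++ [i])) ∨ (f (l ++ [i]) < f y ∧ f y < f l)) := by
    by_contra! hcon
    have ind : ∀ w, w ∈ τ.verts → u <+: w → (f w < f y ↔ f u < f y) := by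
      intro w
      induction w using List.reverseRecOn with
      | nil => intro _ hu; rw [List.prefix_nil.mp hu]
      | append_singleton l i ih =>
        intro hw hu
        rcases prefix_concat.mp hu with e | hu'
        · rw [e]
        · have hl := τ.parent_mem hw
          rw [← ih hl hu']
          have n1 : f l ≠ f y := fun e => huy (bij.injOn hl hy e ▸ hu')
          have n2 : f (l ++ [i]) ≠ f y := fun e => huy (bij.injOn hw hy e ▸ hu)
          have hc := hcon l i hw hu'
          constructor
          · intro h1
            exact lt_of_le_of_ne (hc.2 h1) n1
          · intro h1
            exact lt_of_le_of_ne (hc.1 h1) n2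
    have h1 := (ind x hx hux).mp hxy
    have h2 := (ind z hz huz).mpr h1
    exact absurd h2 (not_lt.mpr hyz.le)
  obtain ⟨a, b, hab, ha, hb, hav⟩ : ∃ a b, θ.adj.Adj a b ∧ a < f y ∧ f y < b ∧
      ∀ w ∈ τ.verts, ¬ u <+: w → f w ≠ a ∧ f w ≠ b := by
    obtain ⟨l, i, hli, hu, hs⟩ := A
    have hl := τ.parent_mem hli
    have n1 : ∀ w ∈ τ.verts, ¬ u <+: w → f w ≠ f l := fun w hw hn e =>
      hn (bij.injOn hw hl e ▸ hu)
    have n2 : ∀ w ∈ τ.verts, ¬ u <+: w → f w ≠ f (l ++ [i]) := fun w hw hn e =>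
      hn (bij.injOn hw hli e ▸ hu.trans (List.prefix_append _ _))
    rcases hs with hs | hs
    · exact ⟨_, _, adj' l i hli, hs.1, hs.2, fun w hw hn => ⟨n1 w hw hn, n2 w hw hn⟩⟩
    · exact ⟨_, _, (adj' l i hli).symm, hs.1, hs.2, fun w hw hn => ⟨n2 w hw hn, n1 w hw hn⟩⟩
  have B : ∀ w, w ∈ τ.verts → ¬ u <+: w → ¬ (a < f w ∧ f w < b) := by
    intro w
    induction w using List.reverseRecOn with
    | nil =>
      rintro _ _ ⟨h1, -⟩
      rw [Fin.lt_def, root] at h1; omega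
    | append_singleton l i ih =>
      rintro hw hu ⟨h1, h2⟩
      have hul : ¬ u <+: l := fun h => hu (h.trans (List.prefix_append _ _))
      have hl := τ.parent_mem hw
      have hne := hav l hl hul
      have e := adj' l i hw
      rcases lt_or_gt_of_ne hne.1 with h3 | h3
      · exact nc_no_cross θ e hab h3 h1 h2
      · rcases lt_or_gt_of_ne hne.2 with h4 | h4
        · exact ih hl hul ⟨h3, h4⟩
        · exact nc_no_cross θ hab e.symm h1 h2 h4
  exact B y hy huy ⟨ha, hb⟩

lemma shape_good {n : ℕ} {θ : NCTree n} {τ : PlaneTree} {f : List ℕ → Fin n}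
    (h : IsShape n θ τ f) : GoodLab n τ f where
  bij := h.2.1
  root := h.2.2.1
  interval := shape_interval h
  incr := fun u i j hi hij hui huj => by
    have := h.2.2.2.2.2 u (τ.parent_mem hui) i j hi hij huj
    rwa [order_iff h.2.1.injOn h.2.2.1 (shape_interval h) u i j hui huj] at this

/-- The graph obtained by transporting the parent-child relation along a labelling. -/
def labGraph (n : ℕ) (τ : PlaneTree) (f : List ℕ → Fin n) : SimpleGraph (Fin n) :=
  SimpleGraph.fromRel fun a b => ∃ u i, u ++ [i] ∈ τ.verts ∧ f u = a ∧ f (u ++ [i]) = b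

lemma labGraph_adj {n : ℕ} {τ : PlaneTree} {f : List ℕ → Fin n} (hf : GoodLab n τ f)
    {u : List ℕ} {i : ℕ} (h : u ++ [i] ∈ τ.verts) : (labGraph n τ f).Adj (f u) (f (u ++ [i])) := by
  rw [labGraph, SimpleGraph.fromRel_adj]
  exact ⟨hf.ne (τ.parent_mem h) h (by simp), Or.inl ⟨u, i, h, rfl, rfl⟩⟩

lemma labGraph_isTree {n : ℕ} {τ : PlaneTree} (hτ : τ.verts.card = n) {f : List ℕ → Fin n}
    (hf : GoodLab n τ f) : (labGraph n τ f).IsTree := by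
  rw [SimpleGraph.isTree_iff_connected_and_card]
  constructor
  · have R : ∀ w, w ∈ τ.verts → (labGraph n τ f).Reachable (f []) (f w) := by
      intro w
      induction w using List.reverseRecOn with
      | nil => intro _; exact SimpleGraph.Reachable.refl _
      | append_singleton l i ih =>
        intro hw
        exact (ih (τ.parent_mem hw)).trans (labGraph_adj hf hw).reachable
    rw [SimpleGraph.connected_iff]
    refine ⟨fun a b => ?_, ⟨f []⟩⟩
    obtain ⟨u, hu, rfl⟩ := hf.bij.surjOn (Set.mem_univ a)
    obtain ⟨v, hv, rfl⟩ := hf.bij.surjOn (Set.mem_univ b)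
    exact (R u hu).symm.trans (R v hv)
  · have hE : (labGraph n τ f).edgeSet =
        (fun u => s(f u.dropLast, f u)) '' (↑(τ.verts.erase []) : Set (List ℕ)) := by
      ext e
      induction e using Sym2.ind with
      | _ a b =>
      simp only [SimpleGraph.mem_edgeSet, Set.mem_image, Finset.mem_coe, Finset.mem_erase]
      constructor
      · intro h
        rw [labGraph, SimpleGraph.fromRel_adj] at h
        rcases h.2 with ⟨u, i, hu, rfl, rfl⟩ | ⟨u, i, hu, rfl, rfl⟩
        · exact ⟨u ++ [i], ⟨by simp, hu⟩, by simp⟩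
        · exact ⟨u ++ [i], ⟨by simp, hu⟩, by simp [Sym2.eq_swap]⟩
      · rintro ⟨u, ⟨hne, hu⟩, he⟩
        rcases List.eq_nil_or_concat u with rfl | ⟨l, k, rfl⟩
        · exact absurd rfl hne
        · rw [List.concat_eq_append] at *
          rw [List.dropLast_concat] at he
          rw [← SimpleGraph.mem_edgeSet, ← he]
          exact labGraph_adj hf hu
    have inj : Set.InjOn (fun u => s(f u.dropLast, f u))
        (↑(τ.verts.erase []) : Set (List ℕ)) := by
      intro u hu v hv h
      simp only [Finset.coe_erase, Set.mem_diff, Finset.mem_coe, Set.mem_singleton_iff] at hu hv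
      have hu' := τ.prefix_closed _ _ (List.dropLast_prefix u) hu.1
      have hv' := τ.prefix_closed _ _ (List.dropLast_prefix v) hv.1
      rcases Sym2.eq_iff.mp h with ⟨_, h2⟩ | ⟨h1, h2⟩
      · exact hf.bij.injOn hu.1 hv.1 h2
      · have e1 := congrArg List.length (hf.bij.injOn hu' hv.1 h1)
        have e2 := congrArg List.length (hf.bij.injOn hu.1 hv' h2)
        have := List.length_pos_iff.mpr hu.2
        rw [List.length_dropLast] at e1 e2
        omega
    rw [Nat.card_coe_set_eq, hE, inj.ncard_image, Set.ncard_coe_finset,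
      Finset.card_erase_of_mem τ.root_mem, hτ, Nat.card_fin]
    have := Finset.card_pos.mpr ⟨_, τ.root_mem⟩
    omega

/-- An interval subtree separates the edges inside it from those outside. -/
lemma sep_aux {n : ℕ} {τ : PlaneTree} {f : List ℕ → Fin n} (hf : GoodLab n τ f)
    {p u q v : List ℕ} (hp : p ∈ τ.verts) (hu : u ∈ τ.verts) (hq : q ∈ τ.verts) (hv : v ∈ τ.verts)
    (hpu : p <+: u) (hpq : ¬ p <+: q) (hpv : ¬ p <+: v) :
    (¬ (f p < f q ∧ f q < f u)) ∧ (¬ (f p < f v ∧ f v < f u)) ∧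
    (¬ (f u < f q ∧ f q < f p)) ∧ (¬ (f u < f v ∧ f v < f p)) := by
  have r := List.prefix_refl p
  refine ⟨fun h => ?_, fun h => ?_, fun h => ?_, fun h => ?_⟩
  · exact hpq (hf.interval p p q u hp hq hu r hpu h.1 h.2)
  · exact hpv (hf.interval p p v u hp hv hu r hpu h.1 h.2)
  · exact hpq (hf.interval p u q p hu hq hp hpu r h.1 h.2)
  · exact hpv (hf.interval p u v p hu hv hp hpu r h.1 h.2)

/-- Edges of the transported graph are never interleaved. -/
lemma no_interleave {n : ℕ} {τ : PlaneTree} {f : List ℕ → Fin n} (hf : GoodLab n τ f)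
    {a b c d : Fin n} (hab : (labGraph n τ f).Adj a b) (hcd : (labGraph n τ f).Adj c d)
    (h1 : a < c) (h2 : c < b) (h3 : b < d) : False := by
  rw [labGraph, SimpleGraph.fromRel_adj] at hab hcd
  obtain ⟨p, i, hpi, hA⟩ : ∃ p i, p ++ [i] ∈ τ.verts ∧
      ((f p = a ∧ f (p ++ [i]) = b) ∨ (f p = b ∧ f (p ++ [i]) = a)) := by
    rcases hab.2 with ⟨u, i, hu, h⟩ | ⟨u, i, hu, h⟩
    · exact ⟨u, i, hu, Or.inl h⟩
    · exact ⟨u, i, hu, Or.inr h⟩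
  obtain ⟨q, j, hqj, hB⟩ : ∃ p i, p ++ [i] ∈ τ.verts ∧
      ((f p = c ∧ f (p ++ [i]) = d) ∨ (f p = d ∧ f (p ++ [i]) = c)) := by
    rcases hcd.2 with ⟨u, i, hu, h⟩ | ⟨u, i, hu, h⟩
    · exact ⟨u, i, hu, Or.inl h⟩
    · exact ⟨u, i, hu, Or.inr h⟩
  have hp := τ.parent_mem hpi
  have hq := τ.parent_mem hqj
  by_cases hpq : p <+: q
  · by_cases hqp : q <+: p
    · have : p = q := hpq.eq_of_length_le hqp.length_le
      subst this
      rcases hA with ⟨rfl, _⟩ | ⟨rfl, _⟩ <;> rcases hB with ⟨h, _⟩ | ⟨h, _⟩ <;>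
        simp only [Fin.lt_def, Fin.ext_iff] at * <;> omega
    · by_cases e : q = p ++ [i]
      · subst e
        rcases hA with ⟨rfl, h⟩ | ⟨rfl, h⟩ <;> rcases hB with ⟨h', _⟩ | ⟨h', _⟩ <;>
          simp only [Fin.lt_def, Fin.ext_iff] at * <;> omega
      have hqpi : ¬ q <+: p ++ [i] := fun h => (prefix_concat.mp h).elim e hqp
      have S := sep_aux hf hq hqj hp hpi (List.prefix_append _ _) hqp hqpi
      rcases hA with ⟨rfl, rfl⟩ | ⟨rfl, rfl⟩ <;> rcases hB with ⟨rfl, rfl⟩ | ⟨rfl, rfl⟩ <;>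
        simp only [Fin.lt_def] at * <;> omega
  · by_cases e : p = q ++ [j]
    · subst e
      rcases hA with ⟨rfl, h⟩ | ⟨rfl, h⟩ <;> rcases hB with ⟨_, h'⟩ | ⟨_, h'⟩ <;>
        simp only [Fin.lt_def, Fin.ext_iff] at * <;> omega
    have hpqj : ¬ p <+: q ++ [j] := fun h => (prefix_concat.mp h).elim e hpq
    have S := sep_aux hf hp hpi hq hqj (List.prefix_append _ _) hpq hpqj
    rcases hA with ⟨rfl, rfl⟩ | ⟨rfl, rfl⟩ <;> rcases hB with ⟨rfl, rfl⟩ | ⟨rfl, rfl⟩ <;>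
      simp only [Fin.lt_def] at * <;> omega

lemma noncrossing_of_adj {n : ℕ} (G : SimpleGraph (Fin n))
    (hG : ∀ a b c d : Fin n, G.Adj a b → G.Adj c d → a < c → c < b → b < d → False)
    (a b c d : Fin n) (hab : G.Adj a b) (hcd : G.Adj c d)
    (hne : ({(a : ℕ), (b : ℕ)} : Set ℕ) ≠ {(c : ℕ), (d : ℕ)}) :
    segment ℝ (ncPos n a) (ncPos n b) ∩ segment ℝ (ncPos n c) (ncPos n d) ⊆
      {z : ℂ | (z = ncPos n a ∨ z = ncPos n b) ∧ (z = ncPos n c ∨ z = ncPos n d)} := by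
  have main : ∀ a b : Fin n, G.Adj a b → ({(a : ℕ), (b : ℕ)} : Set ℕ) ≠ {(c : ℕ), (d : ℕ)} →
      a < b → segment ℝ (ncPos n a) (ncPos n b) ∩ segment ℝ (ncPos n c) (ncPos n d) ⊆
      {z : ℂ | (z = ncPos n a ∨ z = ncPos n b) ∧ (z = ncPos n c ∨ z = ncPos n d)} := by
    intro a b hab hne hlt
    refine noncrossing_aux hlt b.2 c.2 d.2 ?_ ⟨?_, ?_⟩ ?_ ?_
    · intro e; exact hcd.ne (Fin.ext e)
    · rintro ⟨e1, e2⟩; exact hne (by rw [e1, e2])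
    · rintro ⟨e1, e2⟩; exact hne (by rw [e1, e2, Set.pair_comm])
    · rintro ⟨⟨h1, h2⟩, h3 | h3⟩
      · exact hG d c a b hcd.symm hab h3 h1 h2
      · exact hG a b c d hab hcd h1 h2 h3
    · rintro ⟨⟨h1, h2⟩, h3 | h3⟩
      · exact hG c d a b hcd hab h3 h1 h2
      · exact hG a b d c hab hcd.symm h1 h2 h3
  rcases lt_or_gt_of_ne hab.ne with h | h
  · exact main a b hab hne h
  · have := main b a hab.symm (by rwa [Set.pair_comm]) h
    rw [segment_symm]
    refine this.trans fun z hz => ⟨hz.1.symm, hz.2⟩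

lemma good_shape {n : ℕ} {τ : PlaneTree} (hτ : τ.verts.card = n) {f : List ℕ → Fin n}
    (hf : GoodLab n τ f) : ∃ θ : NCTree n, IsShape n θ τ f := by
  refine ⟨⟨labGraph n τ f, labGraph_isTree hτ hf, noncrossing_of_adj _
    fun a b c d => no_interleave hf⟩, hτ, hf.bij, hf.root, ?_, ?_, ?_⟩
  · intro u hu hne
    rcases List.eq_nil_or_concat u with rfl | ⟨l, k, rfl⟩
    · exact absurd rfl hne
    · rw [List.concat_eq_append] at *
      rw [List.dropLast_concat]
      exact labGraph_adj hf hu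
  · intro u hu v hv h
    replace h : (labGraph n τ f).Adj (f u) (f v) := h
    rw [labGraph, SimpleGraph.fromRel_adj] at h
    rcases h.2 with ⟨w, i, hw, h1, h2⟩ | ⟨w, i, hw, h1, h2⟩
    · left
      rw [← hf.bij.injOn (τ.parent_mem hw) hu h1, ← hf.bij.injOn hw hv h2, List.dropLast_concat]
    · right
      rw [← hf.bij.injOn (τ.parent_mem hw) hv h1, ← hf.bij.injOn hw hu h2, List.dropLast_concat]
  · intro u hu i j hi hij hj
    have hi' : u ++ [i] ∈ τ.verts := by
      rw [τ.mem_children] at hj ⊢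
      omega
    rw [order_iff hf.bij.injOn hf.root hf.interval u i j hi' hj]
    exact hf.incr u i j hi hij hi' hj

/-! ### Uniqueness of the labelling -/

lemma shape_child {n : ℕ} {θ : NCTree n} {τ : PlaneTree} {f g : List ℕ → Fin n}
    (hf : IsShape n θ τ f) (hg : IsShape n θ τ g) {l : List ℕ}
    (e1 : f l = g l) (e2 : f l.dropLast = g l.dropLast) {i : ℕ} (hi : l ++ [i] ∈ τ.verts) :
    ∃ j, l ++ [j] ∈ τ.verts ∧ f (l ++ [i]) = g (l ++ [j]) := by
  have hl := τ.parent_mem hi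
  have hadj := hf.2.2.2.1 _ hi (by simp)
  rw [List.dropLast_concat] at hadj
  obtain ⟨w, hw, hwe⟩ := hg.2.1.surjOn (Set.mem_univ (f (l ++ [i])))
  have hadj' := hadj
  rw [e1, ← hwe] at hadj
  rcases hg.2.2.2.2.1 l hl w hw hadj with h | h
  · rcases List.eq_nil_or_concat w with rfl | ⟨l', k, rfl⟩
    · rw [List.dropLast_nil] at h
      subst h
      exact absurd rfl hadj.ne
    · rw [List.concat_eq_append] at *
      rw [List.dropLast_concat] at h
      subst h
      exact ⟨k, hw, hwe.symm⟩
  · rw [h, ← e2] at hwe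
    have := congrArg List.length (hf.2.1.injOn (τ.prefix_closed _ _ (List.dropLast_prefix l) hl) hi hwe)
    simp at this

lemma shape_unique {n : ℕ} {θ : NCTree n} {τ : PlaneTree} {f g : List ℕ → Fin n}
    (hf : IsShape n θ τ f) (hg : IsShape n θ τ g) (u : List ℕ) :
    u ∈ τ.verts → f u = g u ∧ f u.dropLast = g u.dropLast := by
  have gf := shape_good hf
  have gg := shape_good hg
  induction u using List.reverseRecOn with
  | nil =>
    intro _
    have : f [] = g [] := Fin.ext (by rw [gf.root, gg.root])
    exact ⟨this, this⟩
  | append_singleton l i ih =>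
    intro hli
    obtain ⟨e1, e2⟩ := ih (τ.parent_mem hli)
    rw [List.dropLast_concat]
    refine ⟨?_, e1⟩
    induction i using Nat.strong_induction_on with
    | _ i ihi =>
    have le1 : g (l ++ [i]) ≤ f (l ++ [i]) := by
      obtain ⟨j, hj, e⟩ := shape_child hf hg e1 e2 hli
      rcases lt_trichotomy j i with h | h | h
      · exfalso
        rw [← ihi j h hj] at e
        exact (gf.incr l j i (τ.label_pos hj) h hj hli).ne e.symm
      · subst h; exact e.ge
      · rw [e]; exact (gg.incr l i j (τ.label_pos hli) h hli hj).le
    have le2 : f (l ++ [i]) ≤ g (l ++ [i]) := by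
      obtain ⟨j, hj, e⟩ := shape_child hg hf e1.symm e2.symm hli
      rcases lt_trichotomy j i with h | h | h
      · exfalso
        rw [ihi j h hj] at e
        exact (gg.incr l j i (τ.label_pos hj) h hj hli).ne e.symm
      · subst h; exact e.ge
      · rw [e]; exact (gf.incr l i j (τ.label_pos hli) h hli hj).le
    exact le_antisymm le2 le1

lemma tree_unique {n : ℕ} {θ θ' : NCTree n} {τ : PlaneTree} {f g : List ℕ → Fin n}
    (hf : IsShape n θ τ f) (hg : IsShape n θ' τ g) (h : ∀ u ∈ τ.verts, f u = g u) : θ = θ' := by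
  have one : ∀ (θ θ' : NCTree n) (f g : List ℕ → Fin n), IsShape n θ τ f → IsShape n θ' τ g →
      (∀ u ∈ τ.verts, f u = g u) → ∀ a b, θ.adj.Adj a b → θ'.adj.Adj a b := by
    intro θ θ' f g hf hg h a b hab
    obtain ⟨u, hu, rfl⟩ := hf.2.1.surjOn (Set.mem_univ a)
    obtain ⟨v, hv, rfl⟩ := hf.2.1.surjOn (Set.mem_univ b)
    have hne : u ≠ v := fun e => hab.ne (by rw [e])
    rw [h u hu, h v hv]
    rcases hf.2.2.2.2.1 u hu v hv hab with e | e
    · rw [e]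
      exact hg.2.2.2.1 v hv (fun e' => hne (by rw [e, e', List.dropLast_nil]))
    · rw [e]
      exact (hg.2.2.2.1 u hu (fun e' => hne (by rw [e, e', List.dropLast_nil]))).symm
  have : θ.adj = θ'.adj := by
    ext a b
    exact ⟨one θ θ' f g hf hg h a b, one θ' θ g f hg hf (fun u hu => (h u hu).symm) a b⟩
  cases θ; cases θ'; simp only at this; subst this; rfl

/-! ### The order attached to a choice of numbers of left children -/

/-- The sorting key of a word `u`. -/
def ncKey (ℓ : List ℕ → ℕ) (u : List ℕ) : List ℕ := u.map (fun i => 2 * i) ++ [2 * ℓ u + 1]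

lemma append_lt_append (w a b : List ℕ) : w ++ a < w ++ b ↔ a < b := by
  induction w with
  | nil => simp
  | cons x w ih => simp [List.cons_lt_cons_iff, ih]

lemma key_diverge (ℓ : List ℕ → ℕ) (w u v : List ℕ) {i j : ℕ} (h : i < j) :
    ncKey ℓ (w ++ i :: u) < ncKey ℓ (w ++ j :: v) := by
  unfold ncKey
  simp only [List.map_append, List.map_cons, List.append_assoc, List.cons_append]
  rw [append_lt_append, List.cons_lt_cons_iff]
  left; omega

lemma key_child_lt (ℓ : List ℕ → ℕ) (u v : List ℕ) (i : ℕ) :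
    ncKey ℓ (u ++ i :: v) < ncKey ℓ u ↔ i ≤ ℓ u := by
  unfold ncKey
  simp only [List.map_append, List.map_cons, List.append_assoc, List.cons_append]
  rw [append_lt_append, List.cons_lt_cons_iff]
  constructor
  · rintro (h | ⟨h, _⟩) <;> omega
  · intro h; left; omega

lemma key_lt_child (ℓ : List ℕ → ℕ) (u v : List ℕ) (i : ℕ) :
    ncKey ℓ u < ncKey ℓ (u ++ i :: v) ↔ ℓ u < i := by
  unfold ncKey
  simp only [List.map_append, List.map_cons, List.append_assoc, List.cons_append]
  rw [append_lt_append, List.cons_lt_cons_iff]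
  constructor
  · rintro (h | ⟨h, _⟩) <;> omega
  · intro h; left; omega

lemma word_cases (u v : List ℕ) : u = v ∨
    (∃ w i j u' v', i ≠ j ∧ u = w ++ i :: u' ∧ v = w ++ j :: v') ∨
    (∃ i t, v = u ++ i :: t) ∨ (∃ i t, u = v ++ i :: t) := by
  induction u generalizing v with
  | nil =>
    cases v with
    | nil => left; rfl
    | cons j v => right; right; left; exact ⟨j, v, rfl⟩
  | cons i u ih =>
    cases v with
    | nil => right; right; right; exact ⟨i, u, rfl⟩
    | cons j v =>
      by_cases e : i = j
      · subst e
        rcases ih v with h | ⟨w, a, b, u', v', h, h1, h2⟩ | ⟨a, t, h⟩ | ⟨a, t, h⟩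
        · left; rw [h]
        · right; left; exact ⟨i :: w, a, b, u', v', h, by rw [h1]; rfl, by rw [h2]; rfl⟩
        · right; right; left; exact ⟨a, t, by rw [h]; rfl⟩
        · right; right; right; exact ⟨a, t, by rw [h]; rfl⟩
      · right; left; exact ⟨[], i, j, u, v, e, rfl, rfl⟩

lemma key_inj (ℓ : List ℕ → ℕ) {u v : List ℕ} (h : ncKey ℓ u = ncKey ℓ v) : u = v := by
  rcases word_cases u v with e | ⟨w, a, b, u', v', hne, rfl, rfl⟩ | ⟨a, t, rfl⟩ | ⟨a, t, rfl⟩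
  · exact e
  · rcases lt_or_gt_of_ne hne with hl | hl
    · exact absurd h (key_diverge ℓ w u' v' hl).ne
    · exact absurd h (key_diverge ℓ w v' u' hl).ne'
  · have h1 := (key_child_lt ℓ u t a).not.mp (by rw [h]; exact lt_irrefl _)
    have h2 := (key_lt_child ℓ u t a).not.mp (by rw [h]; exact lt_irrefl _)
    omega
  · have h1 := (key_child_lt ℓ v t a).not.mp (by rw [h]; exact lt_irrefl _)
    have h2 := (key_lt_child ℓ v t a).not.mp (by rw [h]; exact lt_irrefl _)
    omega

/-- The rank of a word among the vertices. -/
def ncRank (τ : PlaneTree) (ℓ : List ℕ → ℕ) (u : List ℕ) : ℕ :=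
  (τ.verts.filter fun v => ncKey ℓ v < ncKey ℓ u).card

lemma rank_lt (τ : PlaneTree) (ℓ : List ℕ → ℕ) {u : List ℕ} (hu : u ∈ τ.verts) :
    ncRank τ ℓ u < τ.verts.card := by
  apply Finset.card_lt_card
  rw [Finset.ssubset_iff_of_subset (Finset.filter_subset _ _)]
  exact ⟨u, hu, by simp⟩

lemma rank_mono (τ : PlaneTree) (ℓ : List ℕ → ℕ) {u v : List ℕ} (hu : u ∈ τ.verts)
    (h : ncKey ℓ u < ncKey ℓ v) : ncRank τ ℓ u < ncRank τ ℓ v := by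
  apply Finset.card_lt_card
  rw [Finset.ssubset_iff_of_subset]
  · exact ⟨u, by simp [hu, h], by simp⟩
  · intro w hw
    rw [Finset.mem_filter] at hw ⊢
    exact ⟨hw.1, hw.2.trans h⟩

/-- The labelling by ranks. -/
def ncLab (n : ℕ) (hn : 1 ≤ n) (τ : PlaneTree) (ℓ : List ℕ → ℕ) (u : List ℕ) : Fin n :=
  if h : ncRank τ ℓ u < n then ⟨ncRank τ ℓ u, h⟩ else ⟨0, hn⟩

section
variable {n : ℕ} (hn : 1 ≤ n) {τ : PlaneTree} (hτ : τ.verts.card = n) (ℓ : List ℕ → ℕ)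

lemma lab_val {n : ℕ} (hn : 1 ≤ n) {τ : PlaneTree} (hτ : τ.verts.card = n) (ℓ : List ℕ → ℕ)
    {u : List ℕ} (hu : u ∈ τ.verts) : (ncLab n hn τ ℓ u : ℕ) = ncRank τ ℓ u := by
  have : ncRank τ ℓ u < n := hτ ▸ rank_lt τ ℓ hu
  simp [ncLab, this]

lemma lab_lt {n : ℕ} (hn : 1 ≤ n) {τ : PlaneTree} (hτ : τ.verts.card = n) (ℓ : List ℕ → ℕ)
    {u v : List ℕ} (hu : u ∈ τ.verts) (hv : v ∈ τ.verts) :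
    ncLab n hn τ ℓ u < ncLab n hn τ ℓ v ↔ ncKey ℓ u < ncKey ℓ v := by
  rw [Fin.lt_def, lab_val hn hτ ℓ hu, lab_val hn hτ ℓ hv]
  refine ⟨fun h => ?_, rank_mono τ ℓ hu⟩
  by_contra hc
  rcases (not_lt.mp hc).lt_or_eq with h' | h'
  · exact absurd (rank_mono τ ℓ hv h') (by omega)
  · rw [key_inj ℓ h'] at h; exact lt_irrefl _ h

lemma lab_good {n : ℕ} (hn : 1 ≤ n) {τ : PlaneTree} (hτ : τ.verts.card = n) (ℓ : List ℕ → ℕ)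
    (h0 : ℓ [] = 0) : GoodLab n τ (ncLab n hn τ ℓ) where
  bij := by
    have inj : Set.InjOn (ncLab n hn τ ℓ) ↑τ.verts := by
      intro u hu v hv h
      have h1 := (lab_lt hn hτ ℓ hu hv).not.mp (by rw [h]; exact lt_irrefl _)
      have h2 := (lab_lt hn hτ ℓ hv hu).not.mp (by rw [h]; exact lt_irrefl _)
      exact key_inj ℓ (le_antisymm (not_lt.mp h2) (not_lt.mp h1))
    refine ⟨fun _ _ => Set.mem_univ _, inj, ?_⟩
    have : τ.verts.image (ncLab n hn τ ℓ) = Finset.univ := by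
      apply Finset.eq_univ_of_card
      rw [Finset.card_image_of_injOn inj, hτ, Fintype.card_fin]
    intro a _
    have ha : a ∈ τ.verts.image (ncLab n hn τ ℓ) := by rw [this]; exact Finset.mem_univ _
    obtain ⟨u, hu, e⟩ := Finset.mem_image.mp ha
    exact ⟨u, hu, e⟩
  root := by
    rw [lab_val hn hτ ℓ τ.root_mem, ncRank, Finset.card_eq_zero, Finset.filter_eq_empty_iff]
    intro v hv
    cases v with
    | nil => exact lt_irrefl _
    | cons i t =>
      have := (key_child_lt ℓ [] t i).not
      rw [List.nil_append] at this
      rw [this, h0]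
      have := τ.labels_pos _ hv i (by simp)
      omega
  interval := by
    intro u x y z hx hy hz hux huz hxy hyz
    rw [lab_lt hn hτ ℓ hx hy] at hxy
    rw [lab_lt hn hτ ℓ hy hz] at hyz
    obtain ⟨x', rfl⟩ := hux
    obtain ⟨z', rfl⟩ := huz
    rcases word_cases u y with e | ⟨w, a, b, u', v', hne, rfl, rfl⟩ | ⟨a, t, rfl⟩ | ⟨a, t, rfl⟩
    · rw [e]
    · simp only [List.append_assoc, List.cons_append] at *
      rcases lt_or_gt_of_ne hne with hl | hl
      · exact absurd (key_diverge ℓ w (u' ++ z') v' hl) (not_lt.mpr hyz.le)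
      · exact absurd (key_diverge ℓ w v' (u' ++ x') hl) (not_lt.mpr hxy.le)
    · exact List.prefix_append _ _
    · simp only [List.append_assoc, List.cons_append] at *
      rw [key_child_lt] at hxy
      rw [key_lt_child] at hyz
      omega
  incr := by
    intro u i j _ hij hi hj
    rw [lab_lt hn hτ ℓ hi hj]
    exact key_diverge ℓ u [] [] hij

lemma lab_left {n : ℕ} (hn : 1 ≤ n) {τ : PlaneTree} (hτ : τ.verts.card = n) (ℓ : List ℕ → ℕ)
    {u : List ℕ} {i : ℕ} (h : u ++ [i] ∈ τ.verts) :
    ncLab n hn τ ℓ (u ++ [i]) < ncLab n hn τ ℓ u ↔ i ≤ ℓ u := by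
  rw [lab_lt hn hτ ℓ h (τ.parent_mem h), key_child_lt]

end

lemma good_order {n : ℕ} {τ : PlaneTree} {f : List ℕ → Fin n} (hf : GoodLab n τ f)
    (ℓ : List ℕ → ℕ)
    (hℓ : ∀ u i, u ++ [i] ∈ τ.verts → (f (u ++ [i]) < f u ↔ i ≤ ℓ u))
    {u v : List ℕ} (hu : u ∈ τ.verts) (hv : v ∈ τ.verts) (h : ncKey ℓ u < ncKey ℓ v) :
    f u < f v := by
  have hne : u ≠ v := fun e => by rw [e] at h; exact lt_irrefl _ h
  have hfne := hf.ne hu hv hne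
  by_contra hcon
  have hlt : f v < f u := lt_of_le_of_ne (not_lt.mp hcon) hfne.symm
  rcases word_cases u v with e | ⟨w, i, j, u', v', hij, rfl, rfl⟩ | ⟨i, t, rfl⟩ | ⟨i, t, rfl⟩
  · exact hne e
  · have hlij : i < j := by
      by_contra hc
      exact absurd (key_diverge ℓ w v' u' (show j < i by omega)) (not_lt.mpr h.le)
    have p1 : (w ++ [i]) <+: w ++ i :: u' := ⟨u', by simp⟩
    have p2 : (w ++ [j]) <+: w ++ j :: v' := ⟨v', by simp⟩
    have m1 := τ.prefix_closed _ _ p1 hu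
    have m2 := τ.prefix_closed _ _ p2 hv
    have hi := hf.incr w i j (τ.label_pos m1) hlij m1 m2
    have q1 : ¬ (w ++ [i]) <+: w ++ j :: v' := by
      rw [List.prefix_append_right_inj]; simp; omega
    have q2 : ¬ (w ++ [j]) <+: w ++ [i] := by
      rw [List.prefix_append_right_inj]; simp; omega
    have n1 := hf.ne m1 hv (fun e => q1 (by rw [← e]))
    rcases lt_or_gt_of_ne n1 with h1 | h1
    · exact q1 (hf.interval _ _ _ _ m1 hv hu (List.prefix_refl _) p1 h1 hlt)
    · exact q2 (hf.interval _ _ _ _ hv m1 m2 p2 (List.prefix_refl _) h1 hi)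
  · have p : (u ++ [i]) <+: u ++ i :: t := ⟨t, by simp⟩
    have m := τ.prefix_closed _ _ p hv
    rw [key_lt_child] at h
    have h1 := (hℓ u i m).not.mpr (by omega)
    have h2 := hf.ne m hu (by simp)
    have h3 : f u < f (u ++ [i]) := lt_of_le_of_ne (not_lt.mp h1) h2.symm
    exact not_concat_pre [] (hf.interval _ _ _ _ hv hu m p (List.prefix_refl _) hlt h3)
  · have p : (v ++ [i]) <+: v ++ i :: t := ⟨t, by simp⟩
    have m := τ.prefix_closed _ _ p hu
    rw [key_child_lt] at h
    have h3 := (hℓ v i m).mpr h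
    exact not_concat_pre [] (hf.interval _ _ _ _ m hv hu (List.prefix_refl _) p h3 hlt)

lemma good_eq_lab {n : ℕ} (hn : 1 ≤ n) {τ : PlaneTree} (hτ : τ.verts.card = n)
    {f : List ℕ → Fin n} (hf : GoodLab n τ f) (ℓ : List ℕ → ℕ)
    (hℓ : ∀ u i, u ++ [i] ∈ τ.verts → (f (u ++ [i]) < f u ↔ i ≤ ℓ u))
    (u : List ℕ) (hu : u ∈ τ.verts) : f u = ncLab n hn τ ℓ u := by
  apply Fin.ext
  rw [lab_val hn hτ ℓ hu, ncRank]
  have hord : ∀ v ∈ τ.verts, (ncKey ℓ v < ncKey ℓ u ↔ f v < f u) := by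
    intro v hv
    refine ⟨good_order hf ℓ hℓ hv hu, fun h => ?_⟩
    by_contra hc
    rcases (not_lt.mp hc).lt_or_eq with h' | h'
    · exact absurd (good_order hf ℓ hℓ hu hv h') (not_lt.mpr h.le)
    · rw [key_inj ℓ h'] at h; exact lt_irrefl _ h
  rw [Finset.filter_congr hord]
  have : (τ.verts.filter fun v => f v < f u).image f = Finset.Iio (f u) := by
    ext a
    simp only [Finset.mem_image, Finset.mem_filter, Finset.mem_Iio]
    constructor
    · rintro ⟨v, ⟨_, h⟩, rfl⟩; exact h
    · intro h
      obtain ⟨v, hv, rfl⟩ := hf.bij.surjOn (Set.mem_univ a)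
      exact ⟨v, ⟨hv, h⟩, rfl⟩
  rw [← Fin.card_Iio (f u), ← this, Finset.card_image_of_injOn]
  intro a ha b hb e
  exact hf.bij.injOn (Finset.mem_filter.mp ha).1 (Finset.mem_filter.mp hb).1 e

/-- The number of children of `u` placed before `u`. -/
noncomputable def leftNum {n : ℕ} (τ : PlaneTree) (f : List ℕ → Fin n) (u : List ℕ) : ℕ :=
  Set.ncard {i : ℕ | u ++ [i] ∈ τ.verts ∧ f (u ++ [i]) < f u}

lemma leftNum_spec {n : ℕ} {τ : PlaneTree} {f : List ℕ → Fin n} (hf : GoodLab n τ f)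
    (u : List ℕ) (i : ℕ) (hi : u ++ [i] ∈ τ.verts) : f (u ++ [i]) < f u ↔ i ≤ leftNum τ f u := by
  have := initial_seg {i : ℕ | u ++ [i] ∈ τ.verts ∧ f (u ++ [i]) < f u}
    ((τ.fin_children u).subset fun _ h => h.1) (fun _ h => τ.label_pos h.1)
    (fun i hi h => by
      have hm := τ.children_closed u i hi h.1
      exact ⟨hm, (hf.incr u i (i + 1) hi (by omega) hm h.1).trans h.2⟩) i
  constructor
  · intro h; exact (this.mp ⟨hi, h⟩).2
  · intro h; exact (this.mpr ⟨τ.label_pos hi, h⟩).2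

lemma leftNum_le {n : ℕ} (τ : PlaneTree) (f : List ℕ → Fin n) (u : List ℕ) :
    leftNum τ f u ≤ τ.kc u :=
  Set.ncard_le_ncard (fun _ h => h.1) (τ.fin_children u)

lemma leftNum_root {n : ℕ} {τ : PlaneTree} {f : List ℕ → Fin n} (hf : GoodLab n τ f) :
    leftNum τ f [] = 0 := by
  have : {i : ℕ | ([] : List ℕ) ++ [i] ∈ τ.verts ∧ f ([] ++ [i]) < f []} = ∅ := by
    ext i
    simp only [Set.mem_setOf_eq, Set.mem_empty_iff_false, iff_false]
    rintro ⟨_, h⟩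
    rw [Fin.lt_def, hf.root] at h
    omega
  rw [leftNum, this, Set.ncard_empty]

/-- Extension of a family of left numbers by zero. -/
def extFam (τ : PlaneTree) (c : (u : ↥(τ.verts.erase [])) → Fin (τ.kc u + 1)) (u : List ℕ) : ℕ :=
  if h : u ∈ τ.verts.erase [] then (c ⟨u, h⟩ : ℕ) else 0

lemma extFam_root (τ : PlaneTree) (c : (u : ↥(τ.verts.erase [])) → Fin (τ.kc u + 1)) :
    extFam τ c [] = 0 := by
  simp [extFam]

/-- For every `n ≥ 1` and every plane tree `τ` with `n` vertices, the number
of noncrossing trees with `n` vertices whose shape equals `τ` is `∏_{u ≠ root} (k_u(τ) + 1)`. -/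
theorem card_ncTree_with_shape (n : ℕ) (hn : 1 ≤ n) (τ : PlaneTree) (hτ : τ.verts.card = n) :
    Nat.card {θ : NCTree n // ∃ f : List ℕ → Fin n, IsShape n θ τ f} =
      ∏ u ∈ τ.verts.erase [], (τ.kc u + 1) := by
  classical
  have ex : ∀ c : (u : ↥(τ.verts.erase [])) → Fin (τ.kc u + 1),
      ∃ θ : NCTree n, IsShape n θ τ (ncLab n hn τ (extFam τ c)) := fun c =>
    good_shape hτ (lab_good hn hτ _ (extFam_root τ c))
  choose Φ hΦ using ex
  let Ψ : ((u : ↥(τ.verts.erase [])) → Fin (τ.kc u + 1)) →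
      {θ : NCTree n // ∃ f : List ℕ → Fin n, IsShape n θ τ f} := fun c => ⟨Φ c, _, hΦ c⟩
  have hbij : Function.Bijective Ψ := by
    constructor
    · intro c c' h
      have hθ : Φ c = Φ c' := congrArg Subtype.val h
      have h1 := hΦ c
      have h2 := hΦ c'
      rw [← hθ] at h2
      have hu := shape_unique h1 h2
      funext ⟨u, hmem⟩
      apply Fin.ext
      have key : ∀ i, u ++ [i] ∈ τ.verts → (i ≤ extFam τ c u ↔ i ≤ extFam τ c' u) := by
        intro i hi
        rw [← lab_left hn hτ (extFam τ c) hi, ← lab_left hn hτ (extFam τ c') hi,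
          (hu _ hi).1, (hu _ (τ.parent_mem hi)).1]
      have e1 : extFam τ c u = c ⟨u, hmem⟩ := by simp only [extFam, dif_pos hmem]
      have e2 : extFam τ c' u = c' ⟨u, hmem⟩ := by simp only [extFam, dif_pos hmem]
      rw [e1, e2] at key
      have b1 := (c ⟨u, hmem⟩).2
      have b2 := (c' ⟨u, hmem⟩).2
      simp only at b1 b2
      simp only [τ.mem_children] at key
      by_contra hne
      rcases lt_or_gt_of_ne hne with hl | hl
      · have := key (c' ⟨u, hmem⟩) ⟨by omega, by omega⟩
        omega
      · have := key (c ⟨u, hmem⟩) ⟨by omega, by omega⟩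
        omega
    · rintro ⟨θ, f, hf⟩
      have gf := shape_good hf
      let c : (u : ↥(τ.verts.erase [])) → Fin (τ.kc u + 1) := fun u =>
        ⟨leftNum τ f u, Nat.lt_succ_of_le (leftNum_le τ f u)⟩
      have hc : ∀ u ∈ τ.verts, extFam τ c u = leftNum τ f u := by
        intro u hu
        by_cases e : u = []
        · rw [e, extFam_root, leftNum_root gf]
        · have : u ∈ τ.verts.erase [] := Finset.mem_erase.mpr ⟨e, hu⟩
          simp only [extFam, dif_pos this, c]
      refine ⟨c, Subtype.ext ?_⟩
      refine tree_unique (hΦ c) hf fun u hu => ?_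
      refine (good_eq_lab hn hτ gf (extFam τ c) (fun u i hi => ?_) u hu).symm
      rw [hc u (τ.parent_mem hi)]
      exact leftNum_spec gf u i hi
  rw [← Nat.card_eq_of_bijective Ψ hbij, Nat.card_pi]
  simp only [Nat.card_fin]
  exact Finset.prod_coe_sort (τ.verts.erase []) (fun u => τ.kc u + 1)
end
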